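/- Every irreducible integrable module V for the twisted full toroidal Lie algebra τ̃ of level zero having finite-dimensional weight spaces with respect to h̃ is a level zero highest weight module for τ̃. -/

import Mathlib

open scoped BigOperators TensorProduct

noncomputable section

/-- Stage 1: a finite-dimensional simple complex Lie algebra `g` together with `n` commuting
automorphisms `σ i` of finite orders `m i`, fixed primitive roots of unity `ξ i`, and the
invariant nondegenerate symmetric bilinear form `bil`. -/
structure PreT where
  n : ℕ
  npos : 0 < n
  m : Fin n → ℕ
  mpos : ∀ i, 0 < m i
  g : Type
  [gLR : LieRing g]
  [gLA : LieAlgebra ℂ g]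
  gfin : FiniteDimensional ℂ g
  gsimple : LieAlgebra.IsSimple ℂ g
  σ : Fin n → (g ≃ₗ⁅ℂ⁆ g)
  σcomm : ∀ i j x, σ i (σ j x) = σ j (σ i x)
  σord : ∀ i x, (fun y => σ i y)^[m i] x = x
  ξ : Fin n → ℂ
  ξprim : ∀ i, IsPrimitiveRoot (ξ i) (m i)
  bil : g →ₗ[ℂ] g →ₗ[ℂ] ℂ
  bil_symm : ∀ x y, bil x y = bil y x
  bil_invariant : ∀ x y z, bil ⁅x, y⁆ z = bil x ⁅y, z⁆
  bil_nondeg : ∀ x, (∀ y, bil x y = 0) → x = 0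
  bil_aut : ∀ i x y, bil (σ i x) (σ i y) = bil x y

attribute [instance] PreT.gLR PreT.gLA

namespace PreT

variable (P : PreT)

/-- membership in the lattice `Γ = m₁ℤ ⊕ … ⊕ mₙℤ`. -/
def inΓ (r : Fin P.n → ℤ) : Prop := ∀ i, (P.m i : ℤ) ∣ r i

/-- the common eigenspace `𝔤_{k̄} = {x | σᵢ x = ξᵢ^{kᵢ} x}`. -/
def gr (k : Fin P.n → ℤ) : Submodule ℂ P.g :=
  ⨅ i, LinearMap.ker
    ((P.σ i).toLinearEquiv.toLinearMap - P.ξ i ^ (k i) • (1 : Module.End ℂ P.g))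

/-- Ĝ-characters: group homomorphisms `ℤⁿ/Γ → ℂˣ` presented as `Γ`-periodic functions. -/
def IsChar (χ : (Fin P.n → ℤ) → ℂ) : Prop :=
  (∀ k l, χ (k + l) = χ k * χ l) ∧ (∀ r, P.inΓ r → χ r = 1)

end PreT

/-- Stage 2: a Cartan subalgebra `h0 = 𝔥_{0̄}` of `𝔤_{0̄}` (abelian and self-normalizing
in `𝔤_{0̄}`). -/
structure Cartan (P : PreT) where
  h0 : Submodule ℂ P.g
  h0_le : h0 ≤ P.gr 0
  h0_ne : h0 ≠ ⊥
  h0_abelian : ∀ x ∈ h0, ∀ y ∈ h0, ⁅x, y⁆ = 0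
  h0_selfnorm : ∀ x ∈ P.gr 0, (∀ h ∈ h0, ⁅h, x⁆ ∈ h0) → x ∈ h0

namespace Cartan

variable {P : PreT} (C : Cartan P)

/-- the full weight space `{x ∈ 𝔤 | [h,x] = α(h)x ∀ h ∈ 𝔥_{0̄}}` of `𝔤` for `α ∈ 𝔥_{0̄}*`. -/
def wtfull (α : Module.Dual ℂ ↥C.h0) : Submodule ℂ P.g :=
  ⨅ h : ↥C.h0, LinearMap.ker
    (LieAlgebra.ad ℂ P.g (h : P.g) - α h • (1 : Module.End ℂ P.g))

/-- the root space `𝔤_{k̄}(α)`. -/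
def wtg (k : Fin P.n → ℤ) (α : Module.Dual ℂ ↥C.h0) : Submodule ℂ P.g :=
  P.gr k ⊓ C.wtfull α

/-- the set `Δ^× = Δ_{0,en}^×` of nonzero roots. -/
def Δen : Set (Module.Dual ℂ ↥C.h0) :=
  {α | α ≠ 0 ∧ ∃ k, C.wtg k α ≠ ⊥}

/-- weights for `h̃ = 𝔥_{0̄} ⊕ ⊕ᵢℂKᵢ ⊕ ⊕ᵢℂdᵢ`: a functional on `𝔥_{0̄}` together with the
values on `K₁,…,Kₙ` and on `d₁,…,dₙ`. -/
abbrev Wt : Type := Module.Dual ℂ ↥C.h0 × (Fin P.n → ℂ) × (Fin P.n → ℂ)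

/-- a real root `γ = α + δ_k` of `τ̃`, regarded as an element of `h̃*`. -/
def rootFn (α : Module.Dual ℂ ↥C.h0) (k : Fin P.n → ℤ) : C.Wt :=
  (α, 0, fun i => (k i : ℂ))

end Cartan

/-- Stage 3: the Lie-torus axioms together with a choice of a positive system and of coroots for
the (extended) root system `Δ_{0,en}`. -/
structure Torus (P : PreT) (C : Cartan P) where
  /-- `𝔤_{0̄}` is a (finite-dimensional) simple Lie algebra: no proper nonzero ideals … -/
  g0_ideals : ∀ U : Submodule ℂ P.g, U ≤ P.gr 0 →
    (∀ x ∈ P.gr 0, ∀ u ∈ U, ⁅x, u⁆ ∈ U) → U = ⊥ ∨ U = P.gr 0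
  /-- … and nonabelian. -/
  g0_nonabelian : ∃ x ∈ P.gr 0, ∃ y ∈ P.gr 0, ⁅x, y⁆ ≠ 0
  /-- condition (M): for `k̄ ≠ 0̄` with `𝔤_{k̄} ≠ 0`, `𝔤_{k̄} ≅ U ⊕ W` with `U` a trivial
  `𝔤_{0̄}`-module and `W` zero or irreducible of dimension `> 1` with weights in `Δ_{0,en}`. -/
  cond_M : ∀ k : Fin P.n → ℤ, ¬ P.inΓ k → P.gr k ≠ ⊥ →
    ∃ U W : Submodule ℂ P.g, U ≤ P.gr k ∧ W ≤ P.gr k ∧ U ⊓ W = ⊥ ∧ U ⊔ W = P.gr k ∧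
      (∀ x ∈ P.gr 0, ∀ u ∈ U, ⁅x, u⁆ = 0) ∧
      (W = ⊥ ∨
        ((∀ U' : Submodule ℂ P.g, U' ≤ W →
            (∀ x ∈ P.gr 0, ∀ u ∈ U', ⁅x, u⁆ ∈ U') → U' = ⊥ ∨ U' = W) ∧
          1 < Module.finrank ℂ ↥W ∧
          W ≤ ⨆ α ∈ insert (0 : Module.Dual ℂ ↥C.h0) C.Δen, C.wtfull α))
  /-- condition (iii): the group generated by `σ₁,…,σₙ` has order `m₁ ⋯ mₙ`. -/
  ord_faithful : ∀ k : Fin P.n → ℤ,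
    (∀ l, P.gr l ≠ ⊥ → (∏ i, P.ξ i ^ (k i * l i)) = 1) → P.inΓ k
  /-- a positive system for `Δ_{0,en}`. -/
  pos : Set (Module.Dual ℂ ↥C.h0)
  pos_sub : pos ⊆ C.Δen
  pos_total : ∀ α ∈ C.Δen, α ∈ pos ∨ -α ∈ pos
  pos_disj : ∀ α ∈ pos, -α ∉ pos
  pos_add : ∀ α ∈ pos, ∀ β ∈ pos, α + β ∈ C.Δen → α + β ∈ pos
  /-- coroots `α∨ ∈ 𝔥_{0̄}`. -/
  coroot : Module.Dual ℂ ↥C.h0 → ↥C.h0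
  coroot_two : ∀ α ∈ C.Δen, α (coroot α) = 2
  coroot_neg : ∀ α ∈ C.Δen, coroot (-α) = - coroot α
  /-- `cnorm α = 2/(α|α)`, characterized via the bilinear form. -/
  cnorm : Module.Dual ℂ ↥C.h0 → ℂ
  cnorm_spec : ∀ α ∈ C.Δen, ∀ h : ↥C.h0,
    P.bil ((coroot α : P.g)) ((h : P.g)) = cnorm α * α h

namespace Torus

variable {P : PreT} {C : Cartan P} (T : Torus P C)

/-- evaluation `λ(γ∨)` of a weight `λ` at the coroot `γ∨ = α∨ + (2/(α|α)) Σᵢ kᵢKᵢ` of the real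
root `γ = α + δ_k`. -/
def corootEval (α : Module.Dual ℂ ↥C.h0) (k : Fin P.n → ℤ) (w : C.Wt) : ℂ :=
  w.1 (T.coroot α) + T.cnorm α * ∑ i, (k i : ℂ) * w.2.1 i

/-- the reflection `r_γ(λ) = λ - λ(γ∨)γ` on `h̃*`. -/
def reflFn (α : Module.Dual ℂ ↥C.h0) (k : Fin P.n → ℤ) : Function.End C.Wt :=
  fun w => w - T.corootEval α k w • C.rootFn α k

/-- the Weyl group `W` of `τ̃`, generated by the reflections in the real roots
(realized inside the monoid of self-maps of `h̃*`; as the generators are involutions this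
coincides with the generated group). -/
def weyl : Submonoid (Function.End C.Wt) :=
  Submonoid.closure {f | ∃ α ∈ C.Δen, ∃ k, f = T.reflFn α k}

end Torus

/-- Stage 4: the twisted full toroidal Lie algebra
`τ̃ = LT ⊕ 𝒵(m) ⊕ 𝒟(m)`.  The elements `E k x` (for `x ∈ 𝔤_{k̄}`), `K r i` and `Dop r i`
(for `r ∈ Γ`) realize `x ⊗ t^k`, `t^r Kᵢ` and `t^r dᵢ`, subject to the standard toroidal
bracket relations, with 2-cocycle `φ = c1 • φ₁ + c2 • φ₂`. -/
structure Toroidal (P : PreT) (C : Cartan P) (T : Torus P C) where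
  τ : Type
  [τLR : LieRing τ]
  [τLA : LieAlgebra ℂ τ]
  E : (Fin P.n → ℤ) → P.g →ₗ[ℂ] τ
  K : (Fin P.n → ℤ) → Fin P.n → τ
  Dop : (Fin P.n → ℤ) → Fin P.n → τ
  c1 : ℂ
  c2 : ℂ
  K_not : ∀ r i, ¬ P.inΓ r → K r i = 0
  Dop_not : ∀ r i, ¬ P.inΓ r → Dop r i = 0
  /-- the relation `Σᵢ rᵢ t^r Kᵢ = 0` coming from `dA(m)` in `𝒵(m) = Ω_{A(m)}/dA(m)`. -/
  K_dA : ∀ r, P.inΓ r → ∑ i, (r i : ℂ) • K r i = 0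
  br_EE : ∀ k l x y, x ∈ P.gr k → y ∈ P.gr l →
    ⁅E k x, E l y⁆ = E (k + l) ⁅x, y⁆ + P.bil x y • ∑ i, (k i : ℂ) • K (k + l) i
  br_EK : ∀ k x, x ∈ P.gr k → ∀ r i, ⁅E k x, K r i⁆ = 0
  br_KK : ∀ r s i j, ⁅K r i, K s j⁆ = 0
  br_DK : ∀ r s, P.inΓ r → P.inΓ s → ∀ i j,
    ⁅Dop r i, K s j⁆ = (s i : ℂ) • K (r + s) j +
      (if i = j then (1 : ℂ) else 0) • ∑ p, (r p : ℂ) • K (r + s) p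
  br_DD : ∀ r s, P.inΓ r → P.inΓ s → ∀ i j,
    ⁅Dop r i, Dop s j⁆ = (s i : ℂ) • Dop (r + s) j - (r j : ℂ) • Dop (r + s) i +
      (c1 * (-(s i : ℂ) * (r j : ℂ)) + c2 * ((r i : ℂ) * (s j : ℂ))) •
        ∑ p, (r p : ℂ) • K (r + s) p
  br_DE : ∀ r, P.inΓ r → ∀ i k x, x ∈ P.gr k → ⁅Dop r i, E k x⁆ = (k i : ℂ) • E (r + k) x
  span_top : Submodule.span ℂ
    ({t | ∃ k x, x ∈ P.gr k ∧ t = E k x} ∪ {t | ∃ r i, P.inΓ r ∧ t = K r i} ∪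
      {t | ∃ r i, P.inΓ r ∧ t = Dop r i}) = ⊤
  E_inj : ∀ k x, x ∈ P.gr k → E k x = 0 → x = 0

attribute [instance] Toroidal.τLR Toroidal.τLA

namespace Toroidal

variable {P : PreT} {C : Cartan P} {T : Torus P C} (X : Toroidal P C T)

/-- the generators `𝔤_{k̄}(α) ⊗ ℂt^k`, `α` positive, of `τ̃₊`. -/
def tauP : Set X.τ :=
  {t | ∃ α ∈ T.pos, ∃ k x, x ∈ C.wtg k α ∧ t = X.E k x}

/-- the generators `𝔤_{k̄}(α) ⊗ ℂt^k`, `α` negative, of `τ̃₋`. -/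
def tauM : Set X.τ :=
  {t | ∃ α, -α ∈ T.pos ∧ ∃ k x, x ∈ C.wtg k α ∧ t = X.E k x}

/-- the generators `𝔤_{k̄}(0) ⊗ ℂt^k`, `t^rKᵢ`, `t^rdᵢ` of `τ̃₀`. -/
def tauZ : Set X.τ :=
  {t | (∃ k x, x ∈ C.wtg k 0 ∧ t = X.E k x) ∨
    (∃ r i, P.inΓ r ∧ (t = X.K r i ∨ t = X.Dop r i))}

/-- the generators of `τ̂ = LT ⊕ 𝒟(m)`. -/
def tauHat : Set X.τ :=
  {t | (∃ k x, x ∈ P.gr k ∧ t = X.E k x) ∨ (∃ r i, P.inΓ r ∧ t = X.Dop r i)}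

/-- the element `I(u,r) = D(u,r) - D(u,0) = Σᵢ uᵢ t^r dᵢ - Σᵢ uᵢ dᵢ`. -/
def Iop (u : Fin P.n → ℂ) (r : Fin P.n → ℤ) : X.τ :=
  ∑ i, u i • X.Dop r i - ∑ i, u i • X.Dop 0 i

/-- generators of `L̃ = I ⋉ L(g̊,σ)`, where `g̊` is the centralizer of `𝔥_{0̄}` in `𝔤`. -/
def Ltil : Set X.τ :=
  {t | (∃ u r, P.inΓ r ∧ t = X.Iop u r) ∨
    (∃ k x, x ∈ P.gr k ∧ x ∈ C.wtfull 0 ∧ t = X.E k x)}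

/-- generators of `I ⋉ (𝔥_{0̄} ⊗ A(m))`. -/
def IhGen : Set X.τ :=
  {t | (∃ u r, P.inΓ r ∧ t = X.Iop u r) ∨
    (∃ r h, P.inΓ r ∧ h ∈ C.h0 ∧ h ∈ P.gr r ∧ h ∈ C.wtfull 0 ∧ t = X.E r h)}

end Toroidal

/-- a representation of `τ̃` on a complex vector space. -/
structure TRep {P : PreT} {C : Cartan P} {T : Torus P C} (X : Toroidal P C T) where
  V : Type
  [Vadd : AddCommGroup V]
  [Vmod : Module ℂ V]
  ρ : X.τ →ₗ[ℂ] Module.End ℂ V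
  ρ_lie : ∀ a b : X.τ, ρ ⁅a, b⁆ = ρ a * ρ b - ρ b * ρ a

attribute [instance] TRep.Vadd TRep.Vmod

namespace TRep

variable {P : PreT} {C : Cartan P} {T : Torus P C} {X : Toroidal P C T} (M : TRep X)

/-- the weight space `V_w` with respect to `h̃`. -/
def wtSp (w : C.Wt) : Submodule ℂ M.V :=
  (⨅ h : ↥C.h0, LinearMap.ker (M.ρ (X.E 0 (h : P.g)) - w.1 h • (1 : Module.End ℂ M.V))) ⊓
  (⨅ i, LinearMap.ker (M.ρ (X.K 0 i) - w.2.1 i • (1 : Module.End ℂ M.V))) ⊓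
  (⨅ i, LinearMap.ker (M.ρ (X.Dop 0 i) - w.2.2 i • (1 : Module.End ℂ M.V)))

/-- the set `P(V)` of weights of `V`. -/
def wts : Set C.Wt := {w | M.wtSp w ≠ ⊥}

/-- `V` is a weight module: `V = ⊕_{λ ∈ h̃*} V_λ`. -/
def IsWeight : Prop := (⨆ w : C.Wt, M.wtSp w) = ⊤

/-- `V` has finite-dimensional weight spaces. -/
def FinWt : Prop := ∀ w : C.Wt, FiniteDimensional ℂ ↥(M.wtSp w)

/-- integrability: `V` is a weight module on which all the root vectors
`x ∈ 𝔤_{k̄}(α) ⊗ ℂt^k`, `α ≠ 0`, act locally nilpotently. -/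
def Integrable : Prop :=
  M.IsWeight ∧ ∀ (k : Fin P.n → ℤ) (α : Module.Dual ℂ ↥C.h0), α ≠ 0 →
    ∀ x ∈ C.wtg k α, ∀ v : M.V, ∃ N : ℕ, (M.ρ (X.E k x) ^ N) v = 0

/-- level zero: the central elements `K₁, …, Kₙ` act trivially. -/
def LevelZero : Prop := ∀ i, M.ρ (X.K 0 i) = 0

/-- irreducibility of `V` over `τ̃`. -/
def Irr : Prop :=
  Nontrivial M.V ∧
    ∀ U : Submodule ℂ M.V, (∀ t : X.τ, ∀ v ∈ U, M.ρ t v ∈ U) → U = ⊥ ∨ U = ⊤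

/-- the Lie torus `LT` acts non-trivially on `V`. -/
def LTnontrivial : Prop := ∃ k x, x ∈ P.gr k ∧ M.ρ (X.E k x) ≠ 0

/-- the highest weight space `V₊ = {v ∈ V | τ̃₊ ⬝ v = 0}`. -/
def Vplus : Submodule ℂ M.V := ⨅ t ∈ X.tauP, LinearMap.ker (M.ρ t)

/-- `U(τ̃₀)v`: the smallest subspace of `V` containing `v` and invariant under `τ̃₀`. -/
def u0span (v : M.V) : Submodule ℂ M.V :=
  sInf {U | v ∈ U ∧ ∀ t ∈ X.tauZ, ∀ u ∈ U, M.ρ t u ∈ U}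

/-- `V` is a level zero highest weight module for `τ̃` (Definition 3.3). -/
def IsHW : Prop :=
  ∃ v : M.V, v ≠ 0 ∧ (∃ w : C.Wt, v ∈ M.wtSp w) ∧
    (∀ U : Submodule ℂ M.V, (∀ t : X.τ, ∀ u ∈ U, M.ρ t u ∈ U) → v ∈ U → U = ⊤) ∧
    (∀ t ∈ X.tauP, M.ρ t v = 0) ∧
    (∀ U : Submodule ℂ M.V, U ≤ M.u0span v →
      (∀ t ∈ X.tauZ, ∀ u ∈ U, M.ρ t u ∈ U) → U = ⊥ ∨ U = M.u0span v) ∧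
    (∀ i, M.ρ (X.K 0 i) = 0)

/-- simultaneous eigenspace for the degree derivations `d₁,…,dₙ`. -/
def dEig (b : Fin P.n → ℂ) : Submodule ℂ M.V :=
  ⨅ i, LinearMap.ker (M.ρ (X.Dop 0 i) - b i • (1 : Module.End ℂ M.V))

/-- the graded piece `V₊(k) = {v ∈ V₊ | dᵢ v = (Λ(dᵢ)+kᵢ) v}`. -/
def VplusGr (Λ : C.Wt) (k : Fin P.n → ℤ) : Submodule ℂ M.V :=
  M.Vplus ⊓ M.dEig (fun i => Λ.2.2 i + (k i : ℂ))

/-- `𝒵(m)` acts trivially on `V`. -/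
def Ztrivial : Prop := ∀ r, P.inΓ r → ∀ i, M.ρ (X.K r i) = 0

end TRep

/-- isomorphism of representations of `τ̃`. -/
def TRepIso {P : PreT} {C : Cartan P} {T : Torus P C} {X : Toroidal P C T}
    (M N : TRep X) : Prop :=
  ∃ e : M.V ≃ₗ[ℂ] N.V, ∀ t v, e (M.ρ t v) = N.ρ t (e v)

/-! ### `sl₂`-triples of endomorphisms -/

section SlTwo

variable {W : Type*} [AddCommGroup W] [Module ℂ W]

/-- `(e, f, h)` is an `sl₂`-triple of endomorphisms of `W`. -/
structure IsEndSl2 (e f h : Module.End ℂ W) : Prop where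
  ef : e * f - f * e = h
  he : h * e - e * h = (2 : ℂ) • e
  hf : h * f - f * h = -((2 : ℂ) • f)

namespace IsEndSl2

variable {e f h : Module.End ℂ W}

lemma symm (t : IsEndSl2 e f h) : IsEndSl2 f e (-h) where
  ef := by rw [← t.ef]; abel
  he := by
    have := t.hf
    rw [neg_mul, mul_neg, ← neg_inj, ← this]; abel
  hf := by
    have := t.he
    rw [neg_mul, mul_neg, ← this]; abel

lemma h_pow_mem (t : IsEndSl2 e f h) {N : Submodule ℂ W} (hN : ∀ w ∈ N, f w ∈ N)
    {u : W} {q : ℂ} (hu : h u - q • u ∈ N) (i : ℕ) :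
    h ((f ^ i) u) - (q - 2 * i) • (f ^ i) u ∈ N := by
  induction i with
  | zero => simpa using hu
  | succ i ih =>
    have h1 := LinearMap.congr_fun t.hf ((f ^ i) u)
    simp only [LinearMap.sub_apply, Module.End.mul_apply, LinearMap.neg_apply,
      LinearMap.smul_apply] at h1
    have h2 := hN _ ih
    rw [map_sub, map_smul] at h2
    rw [pow_succ', Module.End.mul_apply]
    have h3 : h (f ((f ^ i) u)) = f (h ((f ^ i) u)) - (2 : ℂ) • f ((f ^ i) u) := by
      rw [← sub_eq_zero] at h1 ⊢
      rw [← h1]; abel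
    rw [h3]
    convert h2 using 1
    push_cast
    module

lemma e_pow_mem (t : IsEndSl2 e f h) {N : Submodule ℂ W} (hN : ∀ w ∈ N, f w ∈ N)
    {u : W} {q : ℂ} (hu : h u - q • u ∈ N) (heu : e u ∈ N) (i : ℕ) :
    e ((f ^ (i + 1)) u) - ((i + 1) * (q - i)) • (f ^ i) u ∈ N := by
  have key : ∀ w, e (f w) = f (e w) + h w := fun w => by
    have h1 := LinearMap.congr_fun t.ef w
    simp only [LinearMap.sub_apply, Module.End.mul_apply] at h1
    rw [← h1]; abel
  induction i with
  | zero =>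
    have : e (f u) - q • u = f (e u) + (h u - q • u) := by rw [key]; abel
    simpa [this] using N.add_mem (hN _ heu) hu
  | succ i ih =>
    have h1 := t.h_pow_mem hN hu (i + 1)
    have h2 := hN _ ih
    rw [map_sub, map_smul, ← Module.End.mul_apply f (f ^ i), ← pow_succ'] at h2
    rw [pow_succ' f (i + 1), Module.End.mul_apply, key]
    convert N.add_mem h1 h2 using 1
    push_cast
    module

/-- Modulo an invariant subspace, a highest weight vector on which `f` acts nilpotently has
natural weight unless it vanishes. -/
lemma mem_of_forall_ne (t : IsEndSl2 e f h) {N : Submodule ℂ W} (hNe : ∀ w ∈ N, e w ∈ N)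
    (hN : ∀ w ∈ N, f w ∈ N) {u : W} {q : ℂ} (hu : h u - q • u ∈ N) (heu : e u ∈ N)
    {n : ℕ} (hn : (f ^ n) u ∈ N) (hq : ∀ i : ℕ, q ≠ i) : u ∈ N := by
  induction n with
  | zero => simpa using hn
  | succ i ih =>
    refine ih ?_
    have h1 := N.sub_mem (hNe _ hn) (t.e_pow_mem hN hu heu i)
    rw [sub_sub_cancel] at h1
    refine (N.smul_mem_iff (mul_ne_zero (by exact_mod_cast i.succ_ne_zero) ?_)).1 h1
    exact sub_ne_zero.2 (hq i)

lemma exists_primitive (t : IsEndSl2 e f h) {v : W} (hv : v ≠ 0) {p : ℂ} (hp : h v = p • v)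
    (hev : ∃ a : ℕ, (e ^ a) v = 0) :
    ∃ j : ℕ, (e ^ j) v ≠ 0 ∧ e ((e ^ j) v) = 0 ∧ h ((e ^ j) v) = (p + 2 * j) • (e ^ j) v := by
  classical
  have h0 : Nat.find hev ≠ 0 := fun h => hv (by simpa [h] using Nat.find_spec hev)
  obtain ⟨j, hj⟩ := Nat.exists_eq_succ_of_ne_zero h0
  refine ⟨j, fun h => Nat.find_min hev (m := j) (by omega) h, ?_, ?_⟩
  · have := Nat.find_spec hev
    rwa [hj, Nat.succ_eq_add_one, pow_succ', Module.End.mul_apply] at this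
  · have := t.symm.h_pow_mem (N := ⊥) (by simp) (u := v) (q := -p) (by simp [hp]) j
    rw [Submodule.mem_bot, sub_eq_zero, LinearMap.neg_apply] at this
    rw [← neg_inj, this]
    module

lemma exists_int (t : IsEndSl2 e f h) {v : W} (hv : v ≠ 0) {p : ℂ} (hp : h v = p • v)
    (hev : ∃ a : ℕ, (e ^ a) v = 0) (hf : ∀ w, ∃ a : ℕ, (f ^ a) w = 0) : ∃ z : ℤ, p = z := by
  obtain ⟨j, hj, hej, hhj⟩ := t.exists_primitive hv hp hev
  obtain ⟨a, ha⟩ := hf ((e ^ j) v)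
  by_contra! hz
  refine hj ((Submodule.mem_bot ℂ).1 (t.mem_of_forall_ne (N := ⊥) (by simp) (by simp)
    (q := p + 2 * j) (by simp [hhj]) (by simp [hej]) (n := a) (by simp [ha]) fun i hi => ?_))
  refine hz (i - 2 * j) ?_
  push_cast
  rw [← hi]; ring

lemma exists_reflected (t : IsEndSl2 e f h) {v : W} (hv : v ≠ 0) {n : ℕ}
    (hp : h v = (n : ℂ) • v) (hev : ∃ a : ℕ, (e ^ a) v = 0) :
    ∃ j : ℕ, (f ^ (j + n)) ((e ^ j) v) ≠ 0 := by
  obtain ⟨j, hj, hej, hhj⟩ := t.exists_primitive hv hp hev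
  have key : ∀ i : ℕ, i ≤ n + 2 * j → (f ^ i) ((e ^ j) v) ≠ 0 := by
    intro i
    induction i with
    | zero => intro _; simpa using hj
    | succ i ih =>
      intro hi h0
      refine ih (by omega) ?_
      have h1 := t.e_pow_mem (N := ⊥) (by simp) (u := (e ^ j) v) (q := n + 2 * j)
        (by simp [hhj]) (by simp [hej]) i
      rw [h0, map_zero, zero_sub, Submodule.mem_bot, neg_eq_zero, smul_eq_zero] at h1
      refine h1.resolve_left (mul_ne_zero (by exact_mod_cast i.succ_ne_zero) ?_)
      refine sub_ne_zero.2 ?_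
      have : n + 2 * j ≠ i := by omega
      exact_mod_cast this
  exact ⟨j, key _ (by omega)⟩

end IsEndSl2

end SlTwo

/-! ### Finite-dimensionality of finitely generated locally finite modules -/

section LocallyFinite

variable {W : Type*} [AddCommGroup W] [Module ℂ W]

/-- `v` lies in a finite-dimensional `x`-invariant subspace. -/
def IsLocFinAt (x : Module.End ℂ W) (v : W) : Prop :=
  ∃ U : Submodule ℂ W, U.FG ∧ v ∈ U ∧ ∀ u ∈ U, x u ∈ U

lemma isLocFinAt_of_pow_eq_zero {x : Module.End ℂ W} {v : W} {n : ℕ} (h : (x ^ n) v = 0) :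
    IsLocFinAt x v := by
  refine ⟨Submodule.span ℂ (Set.image (fun i => (x ^ i) v) (Set.Iic n)),
    Submodule.fg_span ((Set.finite_Iic n).image _),
    Submodule.subset_span ⟨0, by simp, by simp⟩, fun u hu => ?_⟩
  induction hu using Submodule.span_induction with
  | mem u hu =>
    obtain ⟨i, hi, rfl⟩ := hu
    simp only [← Module.End.mul_apply, ← pow_succ']
    rcases (Set.mem_Iic.1 hi).lt_or_eq with hlt | rfl
    · exact Submodule.subset_span ⟨i + 1, hlt, rfl⟩
    · rw [pow_succ', Module.End.mul_apply, h, map_zero]; exact Submodule.zero_mem _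
  | zero => simp
  | add a b _ _ ha hb => rw [map_add]; exact Submodule.add_mem _ ha hb
  | smul c a _ ha => rw [map_smul]; exact Submodule.smul_mem _ c ha

lemma isLocFinAt_of_mem_iSup_eigenspace {x : Module.End ℂ W} {v : W}
    (h : v ∈ ⨆ μ, x.eigenspace μ) : IsLocFinAt x v := by
  induction h using Submodule.iSup_induction' with
  | mem μ v hv =>
    refine ⟨Submodule.span ℂ {v}, Submodule.fg_span_singleton v,
      Submodule.mem_span_singleton_self v, fun u hu => ?_⟩
    obtain ⟨c, rfl⟩ := Submodule.mem_span_singleton.1 hu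
    rw [map_smul, Module.End.mem_eigenspace_iff.1 hv]
    exact Submodule.smul_mem _ _ (Submodule.smul_mem _ _ (Submodule.mem_span_singleton_self v))
  | zero => exact ⟨⊥, Submodule.fg_bot, by simp, by simp⟩
  | add a b _ _ ha hb =>
    obtain ⟨A, hA, haA, hxA⟩ := ha
    obtain ⟨B, hB, hbB, hxB⟩ := hb
    refine ⟨A ⊔ B, hA.sup hB, Submodule.add_mem_sup haA hbB, fun u hu => ?_⟩
    obtain ⟨y, hy, z, hz, rfl⟩ := Submodule.mem_sup.1 hu
    rw [map_add]
    exact Submodule.add_mem_sup (hxA y hy) (hxB z hz)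

lemma exists_fg_invariant {x : Module.End ℂ W} (hx : ∀ v, IsLocFinAt x v)
    {U : Submodule ℂ W} (hU : U.FG) :
    ∃ U' : Submodule ℂ W, U'.FG ∧ U ≤ U' ∧ ∀ u ∈ U', x u ∈ U' := by
  choose F hF1 hF2 hF3 using hx
  obtain ⟨s, rfl⟩ := hU
  refine ⟨⨆ v ∈ s, F v, Submodule.fg_biSup s F fun v _ => hF1 v,
    Submodule.span_le.2 fun v hv => (le_biSup F hv : F v ≤ _) (hF2 v), fun u hu => ?_⟩
  have : (⨆ v ∈ s, F v) ≤ (⨆ v ∈ s, F v).comap x :=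
    iSup₂_le fun v hv w hw => (le_biSup F hv : F v ≤ _) (hF3 v w hw)
  exact this hu

variable {n : ℕ} (x : Fin n → Module.End ℂ W)

/-- The span of the monomials of degree at most `d` in the `x i`. -/
def monomialSpan (d : ℕ) : Submodule ℂ (Module.End ℂ W) :=
  Submodule.span ℂ {y | ∃ l : List (Fin n), l.length ≤ d ∧ y = (l.map x).prod}

variable {x}

lemma prod_mem_monomialSpan {l : List (Fin n)} {d : ℕ} (h : l.length ≤ d) :
    (l.map x).prod ∈ monomialSpan x d :=
  Submodule.subset_span ⟨l, h, rfl⟩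

lemma mul_mem_monomialSpan (i : Fin n) {y : Module.End ℂ W} {d : ℕ} (hy : y ∈ monomialSpan x d) :
    x i * y ∈ monomialSpan x (d + 1) := by
  induction hy using Submodule.span_induction with
  | mem y hy =>
    obtain ⟨l, hl, rfl⟩ := hy
    exact Submodule.subset_span ⟨i :: l, by simpa using hl, by simp⟩
  | zero => simp
  | add a b _ _ ha hb => rw [mul_add]; exact Submodule.add_mem _ ha hb
  | smul c a _ ha => rw [mul_smul_comm]; exact Submodule.smul_mem _ c ha

lemma perm_sub_mem_monomialSpan
    (hx : ∀ i j, x i * x j - x j * x i ∈ Submodule.span ℂ (Set.range x))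
    {l₁ l₂ : List (Fin n)} (h : l₁.Perm l₂) :
    ∀ d, l₁.length ≤ d + 1 → (l₁.map x).prod - (l₂.map x).prod ∈ monomialSpan x d := by
  induction h with
  | nil => simp
  | @cons a l₁ l₂ hp ih =>
    intro d hd
    rw [List.map_cons, List.map_cons, List.prod_cons, List.prod_cons, ← mul_sub]
    rcases d with _ | d
    · have h0 : l₁ = [] := by simpa using hd
      subst h0
      simp [hp.symm.eq_nil]
    · exact mul_mem_monomialSpan a (ih d (by simpa using hd))
  | swap a b l =>
    intro d hd
    simp only [List.map_cons, List.prod_cons]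
    rw [← mul_assoc, ← mul_assoc, ← sub_mul]
    have h := hx b a
    generalize x b * x a - x a * x b = z at h
    induction h using Submodule.span_induction with
    | mem y hy =>
      obtain ⟨i, rfl⟩ := hy
      exact Submodule.subset_span ⟨i :: l, by simpa using hd, by simp⟩
    | zero => simp
    | add a b _ _ ha hb => rw [add_mul]; exact Submodule.add_mem _ ha hb
    | smul c a _ ha => rw [smul_mul_assoc]; exact Submodule.smul_mem _ c ha
  | trans h₁ _ ih₁ ih₂ =>
    intro d hd
    have := Submodule.add_mem _ (ih₁ d hd) (ih₂ d (h₁.length_eq ▸ hd))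
    simpa using this

lemma monomialSpan_le_sorted
    (hx : ∀ i j, x i * x j - x j * x i ∈ Submodule.span ℂ (Set.range x)) (d : ℕ) :
    monomialSpan x d ≤ Submodule.span ℂ
      {y | ∃ l : List (Fin n), l.Pairwise (· ≥ ·) ∧ y = (l.map x).prod} := by
  induction d with
  | zero =>
    refine Submodule.span_le.2 ?_
    rintro y ⟨l, hl, rfl⟩
    have h0 : l = [] := by simpa using hl
    subst h0
    exact Submodule.subset_span ⟨[], by simp, rfl⟩
  | succ d ih =>
    refine Submodule.span_le.2 ?_
    rintro y ⟨l, hl, rfl⟩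
    have h1 := ih (perm_sub_mem_monomialSpan hx (List.perm_insertionSort (· ≥ ·) l).symm d hl)
    have h2 : ((l.insertionSort (· ≥ ·)).map x).prod ∈ Submodule.span ℂ
        {y | ∃ l : List (Fin n), l.Pairwise (· ≥ ·) ∧ y = (l.map x).prod} :=
      Submodule.subset_span ⟨_, List.pairwise_insertionSort (· ≥ ·) l, rfl⟩
    simpa using Submodule.add_mem _ h1 h2

/-- If finitely many locally finite endomorphisms span a Lie algebra, then every finite-dimensional
subspace is contained in a finite-dimensional invariant one. -/
theorem exists_fg_invariant_of_locFin
    (hx : ∀ i j, x i * x j - x j * x i ∈ Submodule.span ℂ (Set.range x))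
    (hlf : ∀ i v, IsLocFinAt (x i) v) {U : Submodule ℂ W} (hU : U.FG) :
    ∃ N : Submodule ℂ W, N.FG ∧ U ≤ N ∧ ∀ i, ∀ u ∈ N, x i u ∈ N := by
  have step : ∀ k (A : {A : Submodule ℂ W // A.FG}), ∃ B : {A : Submodule ℂ W // A.FG},
      A.1 ≤ B.1 ∧ ∀ h : k < n, ∀ u ∈ B.1, x ⟨k, h⟩ u ∈ B.1 := by
    intro k A
    by_cases h : k < n
    · obtain ⟨B, hB, hAB, hxB⟩ := exists_fg_invariant (hlf ⟨k, h⟩) A.2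
      exact ⟨⟨B, hB⟩, hAB, fun _ => hxB⟩
    · exact ⟨A, le_rfl, fun h' => absurd h' h⟩
  choose F hF1 hF2 using step
  let B : ℕ → {A : Submodule ℂ W // A.FG} := fun k => Nat.rec ⟨U, hU⟩ (fun k A => F k A) k
  have hB : Monotone fun k => (B k).1 := monotone_nat_of_le_succ fun k => hF1 k (B k)
  have sorted_mem : ∀ l : List (Fin n), l.Pairwise (· ≥ ·) → ∀ k : ℕ, (∀ a ∈ l, a.val < k) →
      ∀ u ∈ U, (l.map x).prod u ∈ (B k).1 := by
    intro l
    induction l with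
    | nil => intro _ k _ u hu; simpa using hB (Nat.zero_le k) hu
    | cons a l ih =>
      intro hl k hk u hu
      rw [List.pairwise_cons] at hl
      have h1 := ih hl.2 (a.val + 1) (fun b hb => Nat.lt_succ_of_le (hl.1 b hb)) u hu
      rw [List.map_cons, List.prod_cons, Module.End.mul_apply]
      exact hB (hk a (by simp)) (hF2 a.val (B a.val) a.isLt _ h1)
  let N : Submodule ℂ W :=
    Submodule.span ℂ {w | ∃ l : List (Fin n), ∃ u ∈ U, w = (l.map x).prod u}
  have hN : N ≤ (B n).1 := by
    refine Submodule.span_le.2 ?_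
    rintro _ ⟨l, u, hu, rfl⟩
    have h1 := monomialSpan_le_sorted hx _ (prod_mem_monomialSpan (le_refl l.length))
    have h2 : Submodule.span ℂ {y | ∃ l : List (Fin n), l.Pairwise (· ≥ ·) ∧ y = (l.map x).prod} ≤
        (B n).1.comap (LinearMap.applyₗ u) := by
      refine Submodule.span_le.2 ?_
      rintro _ ⟨l, hl, rfl⟩
      exact sorted_mem l hl n (fun a _ => a.isLt) u hu
    exact h2 h1
  have : FiniteDimensional ℂ (B n).1 := Module.Finite.iff_fg.2 (B n).2
  have hfd : FiniteDimensional ℂ N := Submodule.finiteDimensional_of_le hN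
  refine ⟨N, Module.Finite.iff_fg.1 hfd,
    fun u hu => Submodule.subset_span ⟨[], u, hu, by simp⟩, fun i u hu => ?_⟩
  induction hu using Submodule.span_induction with
  | mem w hw =>
    obtain ⟨l, u, hu, rfl⟩ := hw
    exact Submodule.subset_span ⟨i :: l, u, hu, by simp⟩
  | zero => simp
  | add a b _ _ ha hb => rw [map_add]; exact Submodule.add_mem _ ha hb
  | smul c a _ ha => rw [map_smul]; exact Submodule.smul_mem _ c ha

end LocallyFinite

/-! ### Simultaneous diagonalization -/

section Diagonalization

variable {W : Type*} [AddCommGroup W] [Module ℂ W]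

lemma maxGenEigenspace_le_eigenspace_of_iSup_eq_top {f : Module.End ℂ W}
    (hf : ⨆ μ, f.eigenspace μ = ⊤) (μ : ℂ) : f.maxGenEigenspace μ ≤ f.eigenspace μ := by
  intro u hu
  have hle : ∀ ν, f.eigenspace ν ≤ f.maxGenEigenspace ν := fun ν =>
    (f.genEigenspace ν).monotone le_top
  have hu' : u ∈ f.eigenspace μ ⊔ ⨆ ν ≠ μ, f.eigenspace ν := by
    have : u ∈ (⊤ : Submodule ℂ W) := trivial
    rw [← hf] at this
    refine (iSup_le fun ν => ?_ : (⨆ ν, f.eigenspace ν) ≤ _) this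
    by_cases h : ν = μ
    · subst h; exact le_sup_left
    · exact (le_iSup₂_of_le (f := fun ν (_ : ν ≠ μ) => f.eigenspace ν) ν h le_rfl).trans
        le_sup_right
  obtain ⟨y, hy, z, hz, rfl⟩ := Submodule.mem_sup.1 hu'
  have hz0 : z = 0 := by
    have hd := f.independent_maxGenEigenspace μ
    rw [Submodule.disjoint_def] at hd
    refine hd z ?_ ?_
    · simpa using Submodule.sub_mem _ hu (hle μ hy)
    · exact (iSup₂_mono fun ν _ => hle ν) hz
  simpa [hz0] using hy

/-- A finite-dimensional subspace invariant under a commuting family of endomorphisms, each of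
which is diagonalizable on it, is a sum of simultaneous eigenspaces. -/
lemma le_iSup_inf_iInf_eigenspace {ι : Type*} (f : ι → Module.End ℂ W) (p : Submodule ℂ W)
    [FiniteDimensional ℂ W]
    (hp : ∀ i, ∀ x ∈ p, f i x ∈ p) (hcomm : ∀ i j, ∀ x ∈ p, f i (f j x) = f j (f i x))
    (hdiag : ∀ i, p ≤ ⨆ μ, (f i).eigenspace μ) :
    p ≤ ⨆ χ : ι → ℂ, p ⊓ ⨅ i, (f i).eigenspace (χ i) := by
  let g : ι → Module.End ℂ p := fun i => (f i).restrict (hp i)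
  have hg : ∀ i, ⨆ μ, (g i).eigenspace μ = ⊤ := by
    intro i
    have h1 : p ⊓ ⨆ μ, (f i).eigenspace μ = ⨆ μ, p ⊓ (f i).eigenspace μ :=
      Submodule.inf_iSup_genEigenspace (f := f i) (p := p) (hp i) 1
    have h2 : ∀ μ, p ⊓ (f i).eigenspace μ = ((g i).eigenspace μ).map p.subtype := fun μ =>
      Submodule.inf_genEigenspace (f i) p (hp i)
    rw [inf_eq_left.2 (hdiag i)] at h1
    simp only [h2] at h1
    apply Submodule.map_injective_of_injective p.injective_subtype
    rw [Submodule.map_iSup, ← h1, Submodule.map_top, Submodule.range_subtype]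
  have hmax : ∀ i μ, (g i).maxGenEigenspace μ = (g i).eigenspace μ := fun i μ =>
    le_antisymm (maxGenEigenspace_le_eigenspace_of_iSup_eq_top (hg i) μ)
      (((g i).genEigenspace μ).monotone le_top)
  have htop := Module.End.iSup_iInf_maxGenEigenspace_eq_top_of_iSup_maxGenEigenspace_eq_top_of_commute
    g (fun i j _ => LinearMap.ext fun x => Subtype.ext (hcomm i j x x.2))
    (fun i => by simpa only [hmax] using hg i)
  simp only [hmax] at htop
  intro x hx
  have hx' : (⟨x, hx⟩ : p) ∈ ⨆ χ : ι → ℂ, ⨅ i, (g i).eigenspace (χ i) := htop ▸ trivial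
  have h3 := Submodule.mem_map_of_mem (f := p.subtype) hx'
  rw [Submodule.map_iSup] at h3
  refine SetLike.le_def.1 (iSup_mono fun χ => ?_) h3
  rintro _ ⟨y, hy, rfl⟩
  refine ⟨y.2, (Submodule.mem_iInf _).2 fun i => ?_⟩
  have := Module.End.mem_eigenspace_iff.1 ((Submodule.mem_iInf _).1 hy i)
  exact Module.End.mem_eigenspace_iff.2 (congrArg Subtype.val this)

end Diagonalization

section Independence

variable {W : Type*} [AddCommGroup W] [Module ℂ W]

/-- Families of simultaneous eigenvectors with distinct eigenvalue systems are independent. -/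
lemma iSupIndep_of_eigenvalues {ι J : Type*} (f : ι → Module.End ℂ W)
    (hf : ∀ i j, Commute (f i) (f j)) (S : J → Submodule ℂ W) (χ : J → ι → ℂ)
    (hχ : Function.Injective χ) (hS : ∀ j, ∀ x ∈ S j, ∀ i, f i x = χ j i • x) : iSupIndep S := by
  have h := Module.End.independent_iInf_maxGenEigenspace_of_forall_mapsTo f
    (fun i j φ => Module.End.mapsTo_maxGenEigenspace_of_comm (hf j i) φ)
  refine (h.comp hχ).mono fun j x hx => (Submodule.mem_iInf _).2 fun i => ?_
  exact ((f i).genEigenspace _).monotone (show (1 : ℕ∞) ≤ ⊤ from le_top)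
    (Module.End.mem_eigenspace_iff.2 (hS j x hx i))

end Independence

namespace PreT

variable {P : PreT}

lemma mem_gr {k : Fin P.n → ℤ} {x : P.g} :
    x ∈ P.gr k ↔ ∀ i, P.σ i x = P.ξ i ^ (k i) • x := by
  simp [gr, Submodule.mem_iInf, sub_eq_zero]

lemma ξ_ne_zero (i : Fin P.n) : P.ξ i ≠ 0 := (P.ξprim i).ne_zero (P.mpos i).ne'

lemma lie_mem_gr {k l : Fin P.n → ℤ} {x y : P.g} (hx : x ∈ P.gr k) (hy : y ∈ P.gr l) :
    ⁅x, y⁆ ∈ P.gr (k + l) := by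
  rw [mem_gr] at *
  intro i
  rw [LieEquiv.map_lie, hx i, hy i, smul_lie, lie_smul, smul_smul, Pi.add_apply,
    zpow_add₀ (ξ_ne_zero i)]

lemma gr_congr {k l : Fin P.n → ℤ} (h : P.inΓ (k - l)) : P.gr k = P.gr l := by
  have key : ∀ i, P.ξ i ^ (k i) = P.ξ i ^ (l i) := by
    intro i
    have h1 := (P.ξprim i).zpow_eq_one_iff_dvd (k i - l i) |>.2 (h i)
    rwa [zpow_sub₀ (ξ_ne_zero i), div_eq_one_iff_eq (zpow_ne_zero _ (ξ_ne_zero i))] at h1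
  ext x
  simp only [mem_gr, key]

lemma lie_mem_gr_zero {k : Fin P.n → ℤ} {x y : P.g} (hx : x ∈ P.gr 0) (hy : y ∈ P.gr k) :
    ⁅x, y⁆ ∈ P.gr k := by
  simpa using lie_mem_gr hx hy

lemma inΓ_neg {r : Fin P.n → ℤ} (h : P.inΓ r) : P.inΓ (-r) := fun i => by
  simpa using h i

lemma inΓ_zero : P.inΓ 0 := fun i => by simp

lemma inΓ_of_bil_ne_zero {k l : Fin P.n → ℤ} {x y : P.g} (hx : x ∈ P.gr k) (hy : y ∈ P.gr l)
    (h : P.bil x y ≠ 0) : P.inΓ (k + l) := by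
  rw [mem_gr] at *
  intro i
  have h1 := P.bil_aut i x y
  rw [hx i, hy i, map_smul, map_smul, LinearMap.smul_apply, smul_smul, smul_eq_mul,
    ← zpow_add₀ (ξ_ne_zero i), mul_eq_right₀ h] at h1
  rw [← (P.ξprim i).zpow_eq_one_iff_dvd, Pi.add_apply, add_comm, h1]

lemma ad_mul_sub (x y : P.g) :
    LieAlgebra.ad ℂ P.g x * LieAlgebra.ad ℂ P.g y - LieAlgebra.ad ℂ P.g y * LieAlgebra.ad ℂ P.g x =
      LieAlgebra.ad ℂ P.g ⁅x, y⁆ := by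
  ext z
  simp only [LinearMap.sub_apply, Module.End.mul_apply, LieAlgebra.ad_apply, lie_lie]

lemma σ_pow_eq_one (i : Fin P.n) :
    ((P.σ i).toLinearEquiv.toLinearMap : Module.End ℂ P.g) ^ P.m i = 1 := by
  ext x
  rw [Module.End.pow_apply]
  exact P.σord i x

lemma iSup_gr : ⨆ k, P.gr k = ⊤ := by
  have := P.gfin
  let f : Fin P.n → Module.End ℂ P.g := fun i => (P.σ i).toLinearEquiv.toLinearMap
  have hf : ∀ i, (⊤ : Submodule ℂ P.g) ≤ ⨆ μ, (f i).eigenspace μ := by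
    intro i
    have hss : (f i).IsSemisimple := by
      refine Module.End.isSemisimple_of_squarefree_aeval_eq_zero
        (p := Polynomial.X ^ P.m i - 1) ?_ ?_
      · refine Polynomial.Separable.squarefree ?_
        rw [Polynomial.X_pow_sub_one_separable_iff]
        exact_mod_cast (P.mpos i).ne'
      · simp only [map_sub, map_pow, Polynomial.aeval_X, map_one, f, σ_pow_eq_one, sub_self]
    have h := Module.End.iSup_maxGenEigenspace_eq_top (f i)
    simp only [hss.isFinitelySemisimple.maxGenEigenspace_eq_eigenspace] at h
    exact h.ge
  refine top_le_iff.1 ((le_iSup_inf_iInf_eigenspace f ⊤ (by simp)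
    (fun i j x _ => P.σcomm i j x) hf).trans (iSup_le fun χ => ?_))
  rintro x ⟨-, hx⟩
  by_cases hx0 : x = 0
  · rw [hx0]; exact Submodule.zero_mem _
  have hx' : ∀ i, P.σ i x = χ i • x := fun i =>
    Module.End.mem_eigenspace_iff.1 ((Submodule.mem_iInf _).1 hx i)
  have hpow : ∀ i, χ i ^ P.m i = 1 := by
    intro i
    have h1 : ∀ j : ℕ, ((f i) ^ j) x = χ i ^ j • x := by
      intro j
      induction j with
      | zero => simp
      | succ j ih =>
        rw [pow_succ', Module.End.mul_apply, ih, map_smul, pow_succ, mul_smul]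
        congr 1
        exact hx' i
    have h2 := h1 (P.m i)
    rw [σ_pow_eq_one, Module.End.one_apply] at h2
    refine smul_left_injective ℂ hx0 ?_
    simp [← h2]
  have hk : ∀ i, ∃ k : ℕ, P.ξ i ^ k = χ i := fun i => by
    have : NeZero (P.m i) := ⟨(P.mpos i).ne'⟩
    obtain ⟨k, -, hk⟩ := (P.ξprim i).eq_pow_of_pow_eq_one (hpow i)
    exact ⟨k, hk⟩
  choose k hk using hk
  refine Submodule.mem_iSup_of_mem (fun i => (k i : ℤ)) (mem_gr.2 fun i => ?_)
  rw [hx' i, zpow_natCast, hk]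

end PreT

namespace Cartan

variable {P : PreT} {C : Cartan P}

lemma mem_wtfull {α : Module.Dual ℂ ↥C.h0} {x : P.g} :
    x ∈ C.wtfull α ↔ ∀ h : ↥C.h0, ⁅(h : P.g), x⁆ = α h • x := by
  simp [wtfull, Submodule.mem_iInf, sub_eq_zero]

lemma lie_mem_wtfull {α β : Module.Dual ℂ ↥C.h0} {x y : P.g} (hx : x ∈ C.wtfull α)
    (hy : y ∈ C.wtfull β) : ⁅x, y⁆ ∈ C.wtfull (α + β) := by
  rw [mem_wtfull] at *
  intro h
  rw [leibniz_lie, hx h, hy h, smul_lie, lie_smul, LinearMap.add_apply, add_smul]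

lemma lie_mem_wtg {k l : Fin P.n → ℤ} {α β : Module.Dual ℂ ↥C.h0} {x y : P.g}
    (hx : x ∈ C.wtg k α) (hy : y ∈ C.wtg l β) : ⁅x, y⁆ ∈ C.wtg (k + l) (α + β) :=
  ⟨PreT.lie_mem_gr hx.1 hy.1, lie_mem_wtfull hx.2 hy.2⟩

lemma wtg_congr {k l : Fin P.n → ℤ} (h : P.inΓ (k - l)) (α : Module.Dual ℂ ↥C.h0) :
    C.wtg k α = C.wtg l α := by
  rw [wtg, wtg, PreT.gr_congr h]

lemma add_eq_zero_of_bil_ne_zero {α β : Module.Dual ℂ ↥C.h0} {x y : P.g}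
    (hx : x ∈ C.wtfull α) (hy : y ∈ C.wtfull β) (h : P.bil x y ≠ 0) : α + β = 0 := by
  rw [mem_wtfull] at *
  ext z
  have h1 := P.bil_invariant x z y
  rw [← lie_skew, hx z, hy z, map_neg, LinearMap.neg_apply, map_smul, map_smul,
    LinearMap.smul_apply, smul_eq_mul, smul_eq_mul, neg_eq_iff_add_eq_zero, ← add_mul] at h1
  exact (mul_eq_zero.1 h1).resolve_right h

lemma mem_h0_of_mem_wtg {x : P.g} (hx : x ∈ C.wtg 0 0) : x ∈ C.h0 :=
  C.h0_selfnorm x hx.1 fun h hh => by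
    rw [mem_wtfull.1 hx.2 ⟨h, hh⟩]; simp

lemma mem_wtg_of_mem_h0 {x : P.g} (hx : x ∈ C.h0) : x ∈ C.wtg 0 0 :=
  ⟨C.h0_le hx, mem_wtfull.2 fun h => by simp [C.h0_abelian _ h.2 _ hx]⟩

lemma iSupIndep_wtfull : iSupIndep C.wtfull := by
  refine iSupIndep_of_eigenvalues (fun h : ↥C.h0 => LieAlgebra.ad ℂ P.g (h : P.g)) ?_ C.wtfull
    (fun α h => α h) (fun α β h => LinearMap.ext (congrFun h)) fun α x hx h => mem_wtfull.1 hx h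
  intro i j
  refine sub_eq_zero.1 ?_
  rw [PreT.ad_mul_sub, C.h0_abelian _ i.2 _ j.2, map_zero]

lemma finite_wtfull_ne_bot : {α | C.wtfull α ≠ ⊥}.Finite := by
  have := P.gfin
  exact WellFoundedGT.finite_ne_bot_of_iSupIndep iSupIndep_wtfull

variable (C) in
/-- The nonzero roots of `𝔤_{0̄}`. -/
def Δzero : Set (Module.Dual ℂ ↥C.h0) := {α | α ≠ 0 ∧ C.wtg 0 α ≠ ⊥}

lemma Δzero_subset_Δen : C.Δzero ⊆ C.Δen := fun _ h => ⟨h.1, 0, h.2⟩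

lemma finite_Δzero : C.Δzero.Finite :=
  finite_wtfull_ne_bot.subset fun _ h h' => h.2 (by rw [wtg, h', inf_bot_eq])

variable (C) in
/-- Every graded piece of `𝔤` is a sum of weight spaces for `𝔥_{0̄}`. -/
def IsDiag : Prop := ∀ k, P.gr k ≤ ⨆ α, C.wtg k α

lemma IsDiag.iSup_wtg (hd : C.IsDiag) :
    ⨆ p : (Fin P.n → ℤ) × Module.Dual ℂ ↥C.h0, C.wtg p.1 p.2 = ⊤ := by
  rw [iSup_prod, ← top_le_iff, ← PreT.iSup_gr]
  exact iSup_mono hd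

lemma IsDiag.exists_bil_ne_zero (hd : C.IsDiag) {k : Fin P.n → ℤ} {α : Module.Dual ℂ ↥C.h0}
    {e : P.g} (he : e ∈ C.wtg k α) (he0 : e ≠ 0) : ∃ f ∈ C.wtg (-k) (-α), P.bil e f ≠ 0 := by
  by_contra! h
  refine he0 (P.bil_nondeg e fun y => ?_)
  have hy : y ∈ ⨆ p : (Fin P.n → ℤ) × Module.Dual ℂ ↥C.h0, C.wtg p.1 p.2 := by
    rw [hd.iSup_wtg]; trivial
  induction hy using Submodule.iSup_induction' with
  | mem p y hy =>
    by_contra hne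
    have h1 := PreT.inΓ_of_bil_ne_zero he.1 hy.1 hne
    have h2 := add_eq_zero_of_bil_ne_zero he.2 hy.2 hne
    refine hne (h y ?_)
    rw [neg_eq_of_add_eq_zero_right h2, wtg_congr (l := p.1)]
    · exact hy
    · rw [← neg_add']; exact PreT.inΓ_neg h1
  | zero => simp
  | add a b _ _ ha hb => rw [map_add, ha, hb, add_zero]

lemma IsDiag.eq_zero_of_bil_eq_zero (hd : C.IsDiag) {z : ↥C.h0}
    (h : ∀ y : ↥C.h0, P.bil z y = 0) : z = 0 := by
  by_contra hz
  obtain ⟨f, hf, hne⟩ := hd.exists_bil_ne_zero (mem_wtg_of_mem_h0 z.2)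
    (fun h => hz (Subtype.ext h))
  rw [neg_zero, neg_zero] at hf
  exact hne (h ⟨f, mem_h0_of_mem_wtg hf⟩)

lemma neg_mem_Δzero (hd : C.IsDiag) {α : Module.Dual ℂ ↥C.h0} (h : α ∈ C.Δzero) :
    -α ∈ C.Δzero := by
  refine ⟨neg_ne_zero.2 h.1, ?_⟩
  obtain ⟨e, he, he0⟩ := (Submodule.ne_bot_iff _).1 h.2
  obtain ⟨f, hf, hne⟩ := hd.exists_bil_ne_zero he he0
  rw [neg_zero] at hf
  exact (Submodule.ne_bot_iff _).2 ⟨f, hf, fun h => hne (by simp [h])⟩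

lemma pow_ad_mem_wtg {k l : Fin P.n → ℤ} {α β : Module.Dual ℂ ↥C.h0} {e y : P.g}
    (he : e ∈ C.wtg k α) (hy : y ∈ C.wtg l β) (j : ℕ) :
    ((LieAlgebra.ad ℂ P.g e) ^ j) y ∈ C.wtg (j • k + l) (j • α + β) := by
  induction j with
  | zero => simpa using hy
  | succ j ih =>
    rw [pow_succ', Module.End.mul_apply, LieAlgebra.ad_apply]
    convert lie_mem_wtg he ih using 1
    rw [succ_nsmul', succ_nsmul', add_assoc, add_assoc]

lemma IsDiag.exists_pow_ad_eq_zero (hd : C.IsDiag) {k : Fin P.n → ℤ} {α : Module.Dual ℂ ↥C.h0}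
    (hα : α ≠ 0) {e : P.g} (he : e ∈ C.wtg k α) (y : P.g) :
    ∃ a : ℕ, ((LieAlgebra.ad ℂ P.g e) ^ a) y = 0 := by
  have hy : y ∈ ⨆ p : (Fin P.n → ℤ) × Module.Dual ℂ ↥C.h0, C.wtg p.1 p.2 := by
    rw [hd.iSup_wtg]; trivial
  induction hy using Submodule.iSup_induction' with
  | mem p y hy =>
    by_contra! h
    refine Set.infinite_of_injective_forall_mem (f := fun j : ℕ => j • α + p.2) ?_ ?_
      (finite_wtfull_ne_bot (C := C))
    · intro i j hij
      have h1 : ((i : ℂ) - j) • α = 0 := by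
        rw [sub_smul, sub_eq_zero, Nat.cast_smul_eq_nsmul, Nat.cast_smul_eq_nsmul]
        exact add_right_cancel hij
      exact_mod_cast sub_eq_zero.1 ((smul_eq_zero.1 h1).resolve_right hα)
    · exact fun j => (Submodule.ne_bot_iff _).2 ⟨_, (pow_ad_mem_wtg he hy j).2, h j⟩
  | zero => exact ⟨0, by simp⟩
  | add a b _ _ ha hb =>
    obtain ⟨m, hm⟩ := ha
    obtain ⟨n, hn⟩ := hb
    refine ⟨m + n, ?_⟩
    rw [map_add, pow_add, Module.End.mul_apply _ _ b, hn, map_zero, add_zero,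
      (Commute.refl (LieAlgebra.ad ℂ P.g e)).pow_pow m n |>.eq, Module.End.mul_apply, hm, map_zero]

end Cartan

namespace Torus

open Cartan

variable {P : PreT} {C : Cartan P} (T : Torus P C)

/-- Every root vector space contains the raising operator of an `sl₂`-triple whose neutral element
is the given coroot. -/
lemma exists_triple (hd : C.IsDiag) {α : Module.Dual ℂ ↥C.h0} (hα : α ∈ C.Δen)
    {k : Fin P.n → ℤ} (hk : C.wtg k α ≠ ⊥) :
    ∃ e ∈ C.wtg k α, ∃ f ∈ C.wtg (-k) (-α), ⁅e, f⁆ = (T.coroot α : P.g) := by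
  obtain ⟨e, he, he0⟩ := (Submodule.ne_bot_iff _).1 hk
  obtain ⟨f, hf, hne⟩ := hd.exists_bil_ne_zero he he0
  have h1 : ⁅e, f⁆ ∈ C.h0 := by
    have := lie_mem_wtg he hf
    rw [add_neg_cancel, add_neg_cancel] at this
    exact mem_h0_of_mem_wtg this
  have h2 : ∀ h : ↥C.h0, P.bil ⁅e, f⁆ h = α h * P.bil e f := by
    intro h
    rw [P.bil_invariant, ← lie_skew, mem_wtfull.1 hf.2 h, LinearMap.neg_apply, neg_smul, neg_neg,
      map_smul, smul_eq_mul]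
  have h3 : T.cnorm α • (⟨⁅e, f⁆, h1⟩ : ↥C.h0) = P.bil e f • T.coroot α := by
    rw [← sub_eq_zero]
    refine hd.eq_zero_of_bil_eq_zero fun y => ?_
    simp only [Submodule.coe_sub, Submodule.coe_smul, map_sub, map_smul, LinearMap.sub_apply,
      LinearMap.smul_apply, h2, T.cnorm_spec α hα, smul_eq_mul]
    ring
  have h4 : T.cnorm α ≠ 0 := by
    intro h
    have h5 := congrArg α h3
    rw [h, zero_smul, map_zero, map_smul, T.coroot_two α hα, smul_eq_mul] at h5
    exact hne (by simpa using h5.symm)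
  refine ⟨e, he, (T.cnorm α / P.bil e f) • f, Submodule.smul_mem _ _ hf, ?_⟩
  have h5 := congrArg (Subtype.val) h3
  simp only [Submodule.coe_smul] at h5
  rw [lie_smul, div_eq_inv_mul, mul_smul, h5, smul_smul, inv_mul_cancel₀ hne, one_smul]

lemma cnorm_ne_zero (hd : C.IsDiag) {α : Module.Dual ℂ ↥C.h0} (hα : α ∈ C.Δen) :
    T.cnorm α ≠ 0 := by
  intro h
  have h1 : T.coroot α = 0 := hd.eq_zero_of_bil_eq_zero fun y => by
    rw [T.cnorm_spec α hα, h, zero_mul]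
  have h2 := T.coroot_two α hα
  rw [h1, map_zero] at h2
  exact two_ne_zero h2.symm

lemma isEndSl2_ad {k : Fin P.n → ℤ} {α : Module.Dual ℂ ↥C.h0} (hα : α ∈ C.Δen) {e f : P.g}
    (he : e ∈ C.wtg k α) (hf : f ∈ C.wtg (-k) (-α)) (hef : ⁅e, f⁆ = (T.coroot α : P.g)) :
    IsEndSl2 (LieAlgebra.ad ℂ P.g e) (LieAlgebra.ad ℂ P.g f)
      (LieAlgebra.ad ℂ P.g (T.coroot α : P.g)) where
  ef := by rw [PreT.ad_mul_sub, hef]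
  he := by
    rw [PreT.ad_mul_sub, mem_wtfull.1 he.2, T.coroot_two α hα, map_smul]
  hf := by
    rw [PreT.ad_mul_sub, mem_wtfull.1 hf.2, LinearMap.neg_apply,
      T.coroot_two α hα, neg_smul, map_neg, map_smul]

lemma exists_int (hd : C.IsDiag) {α β : Module.Dual ℂ ↥C.h0} (hα : α ∈ C.Δen)
    (hβ : β ∈ C.Δen) : ∃ z : ℤ, β (T.coroot α) = z := by
  obtain ⟨k, hk⟩ := hα.2
  obtain ⟨l, hl⟩ := hβ.2
  obtain ⟨e, he, f, hf, hef⟩ := T.exists_triple hd hα hk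
  obtain ⟨y, hy, hy0⟩ := (Submodule.ne_bot_iff _).1 hl
  exact (T.isEndSl2_ad hα he hf hef).exists_int hy0 (mem_wtfull.1 hy.2 _)
    (hd.exists_pow_ad_eq_zero hα.1 he y)
    (hd.exists_pow_ad_eq_zero (neg_ne_zero.2 hα.1) hf)

lemma add_mem_of_neg (hd : C.IsDiag) {α β : Module.Dual ℂ ↥C.h0} (hα : α ∈ C.Δen)
    (hβ : β ∈ C.Δen) {z : ℤ} (hz : β (T.coroot α) = z) (hneg : z < 0) (hne : α + β ≠ 0) :
    α + β ∈ C.Δen := by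
  obtain ⟨k, hk⟩ := hα.2
  obtain ⟨l, hl⟩ := hβ.2
  obtain ⟨e, he, f, hf, hef⟩ := T.exists_triple hd hα hk
  obtain ⟨y, hy, hy0⟩ := (Submodule.ne_bot_iff _).1 hl
  refine ⟨hne, k + l, (Submodule.ne_bot_iff _).2 ⟨⁅e, y⁆, lie_mem_wtg he hy, fun h0 => ?_⟩⟩
  obtain ⟨a, ha⟩ := hd.exists_pow_ad_eq_zero (neg_ne_zero.2 hα.1) hf y
  refine hy0 ((Submodule.mem_bot ℂ).1 ((T.isEndSl2_ad hα he hf hef).mem_of_forall_ne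
    (N := ⊥) (by simp) (by simp) (q := z) (u := y) ?_ (by simpa using h0) (n := a) (by simp [ha]) ?_))
  · rw [LieAlgebra.ad_apply, mem_wtfull.1 hy.2, hz, sub_self]; exact Submodule.zero_mem _
  · intro i hi
    have : z = i := by exact_mod_cast hi
    omega

/-- The sum of a nonempty family of positive roots is nonzero. -/
lemma sum_pos_ne_zero (hd : C.IsDiag) (l : List (Module.Dual ℂ ↥C.h0)) (hl : l ≠ [])
    (hpos : ∀ α ∈ l, α ∈ T.pos) : l.sum ≠ 0 := by
  classical
  induction hn : l.length using Nat.strong_induction_on generalizing l with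
  | _ n ih =>
  intro hsum
  obtain ⟨α, l', rfl⟩ := List.exists_cons_of_ne_nil hl
  have hα : α ∈ T.pos := hpos α (by simp)
  have hαΔ := T.pos_sub hα
  have hint : ∀ β ∈ l', ∃ z : ℤ, β (T.coroot α) = z := fun β hβ =>
    T.exists_int hd hαΔ (T.pos_sub (hpos β (by simp [hβ])))
  obtain ⟨β, hβ, z, hz, hneg⟩ : ∃ β ∈ l', ∃ z : ℤ, β (T.coroot α) = z ∧ z < 0 := by
    by_contra! hcon
    have key : ∀ m : List (Module.Dual ℂ ↥C.h0), (∀ β ∈ m, β ∈ l') →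
        ∃ z : ℤ, m.sum (T.coroot α) = z ∧ 0 ≤ z := by
      intro m
      induction m with
      | nil => intro _; exact ⟨0, by simp⟩
      | cons β m ihm =>
        intro hm
        obtain ⟨z, hz, hz0⟩ := ihm fun γ hγ => hm γ (by simp [hγ])
        obtain ⟨w, hw⟩ := hint β (hm β (by simp))
        exact ⟨w + z, by simp [hz, hw], add_nonneg (hcon β (hm β (by simp)) w hw) hz0⟩
    obtain ⟨z, hz, hz0⟩ := key l' fun _ h => h
    have h1 := congrArg (fun φ => φ (T.coroot α)) hsum
    simp only [List.sum_cons, LinearMap.add_apply, T.coroot_two α hαΔ, hz,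
      LinearMap.zero_apply] at h1
    have h2 : (2 : ℤ) + z = 0 := by exact_mod_cast h1
    omega
  have hβp : β ∈ T.pos := hpos β (by simp [hβ])
  have hne : α + β ≠ 0 := fun h => T.pos_disj α hα (by rwa [neg_eq_of_add_eq_zero_right h])
  have hmem := T.pos_add α hα β hβp (T.add_mem_of_neg hd hαΔ (T.pos_sub hβp) hz hneg hne)
  have hperm := List.perm_cons_erase hβ
  have hlen : (l'.erase β).length + 1 = l'.length := by rw [hperm.length_eq]; simp
  refine ih (((α + β) :: l'.erase β).length) ?_ ((α + β) :: l'.erase β) (by simp) ?_ rfl ?_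
  · simp only [List.length_cons] at hn ⊢; omega
  · intro γ hγ
    rcases List.mem_cons.1 hγ with rfl | hγ
    · exact hmem
    · exact hpos γ (List.mem_cons_of_mem _ (List.mem_of_mem_erase hγ))
  · rw [List.sum_cons, add_assoc, ← List.sum_cons, ← hperm.sum_eq, ← List.sum_cons, hsum]

lemma eq_zero_of_roots {P : PreT} {C : Cartan P} (T : Torus P C) (hd : C.IsDiag) {z : ↥C.h0} (hz : ∀ α ∈ C.Δzero, α z = 0) : z = 0 := by
  have hcomm : ∀ x ∈ P.gr 0, ⁅(z : P.g), x⁆ = 0 := by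
    intro x hx
    have hx' := hd 0 hx
    induction hx' using Submodule.iSup_induction' with
    | mem α y hy =>
      rw [mem_wtfull.1 hy.2]
      by_cases hy0 : y = 0
      · rw [hy0, smul_zero]
      by_cases hα : α = 0
      · simp [hα]
      · rw [hz α ⟨hα, (Submodule.ne_bot_iff _).2 ⟨y, hy, hy0⟩⟩, zero_smul]
    | zero => simp
    | add a b ha' hb' ha hb =>
      have hle : (⨆ α, C.wtg 0 α) ≤ P.gr 0 := iSup_le fun α => inf_le_left
      rw [lie_add, ha (hle ha'), hb (hle hb'), add_zero]
  have hle : Submodule.span ℂ {(z : P.g)} ≤ P.gr 0 :=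
    (Submodule.span_singleton_le_iff_mem _ _).2 (C.h0_le z.2)
  rcases T.g0_ideals (Submodule.span ℂ {(z : P.g)}) hle (by
    intro x hx u hu
    obtain ⟨c, rfl⟩ := Submodule.mem_span_singleton.1 hu
    rw [lie_smul, ← lie_skew, hcomm x hx]; simp) with h | h
  · rw [Submodule.span_singleton_eq_bot] at h
    exact Subtype.ext h
  · obtain ⟨x, hx, y, hy, hxy⟩ := T.g0_nonabelian
    rw [← h] at hx
    obtain ⟨c, rfl⟩ := Submodule.mem_span_singleton.1 hx
    exact absurd (by rw [smul_lie, hcomm y hy, smul_zero]) hxy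

lemma eq_zero_of_coroots (hd : C.IsDiag) {μ : Module.Dual ℂ ↥C.h0}
    (hμ : ∀ α ∈ C.Δzero, μ (T.coroot α) = 0) : μ = 0 := by
  have := P.gfin
  let B : ↥C.h0 →ₗ[ℂ] Module.Dual ℂ ↥C.h0 := P.bil.domRestrict₁₂ C.h0 C.h0
  have hB : Function.Injective B := by
    rw [← LinearMap.ker_eq_bot, LinearMap.ker_eq_bot']
    exact fun z hz => hd.eq_zero_of_bil_eq_zero fun y => LinearMap.congr_fun hz y
  obtain ⟨z, rfl⟩ := (LinearMap.injective_iff_surjective_of_finrank_eq_finrank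
    (Subspace.dual_finrank_eq (K := ℂ) (V := ↥C.h0)).symm).1 hB μ
  have hz : z = 0 := T.eq_zero_of_roots hd fun α hα => by
    have h1 : P.bil z (T.coroot α) = 0 := hμ α hα
    rw [P.bil_symm, T.cnorm_spec α (Δzero_subset_Δen hα)] at h1
    exact (mul_eq_zero.1 h1).resolve_left (T.cnorm_ne_zero hd (Δzero_subset_Δen hα))
  rw [hz, map_zero]

/-- The reflection in the root `β` acting on `𝔥_{0̄}*`. -/
def reflDual (β α : Module.Dual ℂ ↥C.h0) : Module.Dual ℂ ↥C.h0 := α - α (T.coroot β) • β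

lemma reflDual_involutive {β : Module.Dual ℂ ↥C.h0} (hβ : β ∈ C.Δen) :
    Function.Involutive (T.reflDual β) := by
  intro α
  simp only [reflDual, LinearMap.sub_apply, LinearMap.smul_apply, T.coroot_two β hβ, smul_eq_mul]
  module

lemma reflDual_apply_sub {α β : Module.Dual ℂ ↥C.h0} (hα : α ∈ C.Δen)
    (hβ : β ∈ C.Δen) :
    T.reflDual β α (T.coroot α - β (T.coroot α) • T.coroot β) = 2 := by
  simp only [reflDual, LinearMap.sub_apply, LinearMap.smul_apply, map_sub, map_smul, smul_eq_mul,
    T.coroot_two α hα, T.coroot_two β hβ]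
  ring

lemma reflDual_mem (hd : C.IsDiag) {α β : Module.Dual ℂ ↥C.h0} (hα : α ∈ C.Δzero)
    (hβ : β ∈ C.Δzero) : T.reflDual β α ∈ C.Δzero := by
  have hα' := Δzero_subset_Δen hα
  have hβ' := Δzero_subset_Δen hβ
  refine ⟨fun h => ?_, ?_⟩
  · have h1 := T.reflDual_apply_sub hα' hβ'
    rw [h, LinearMap.zero_apply] at h1
    exact two_ne_zero h1.symm
  obtain ⟨e, he, f, hf, hef⟩ := T.exists_triple hd hβ' hβ.2
  obtain ⟨y, hy, hy0⟩ := (Submodule.ne_bot_iff _).1 hα.2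
  have ht := T.isEndSl2_ad hβ' he hf hef
  obtain ⟨z, hz⟩ := T.exists_int hd hβ' hα'
  have hyz : LieAlgebra.ad ℂ P.g (T.coroot β : P.g) y = (z : ℂ) • y := by
    rw [LieAlgebra.ad_apply, mem_wtfull.1 hy.2, hz]
  rw [neg_zero] at hf
  rcases Int.eq_nat_or_neg z with ⟨n, rfl | rfl⟩
  · obtain ⟨j, hj⟩ := ht.exists_reflected (n := n) hy0 (by simpa using hyz)
      (hd.exists_pow_ad_eq_zero hβ.1 he y)
    refine (Submodule.ne_bot_iff _).2 ⟨_, ?_, hj⟩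
    convert pow_ad_mem_wtg hf (pow_ad_mem_wtg he hy j) (j + n) using 1
    simp only [smul_zero, add_zero]
    congr 1
    rw [reflDual, hz]
    push_cast
    module
  · obtain ⟨j, hj⟩ := ht.symm.exists_reflected (n := n) hy0
      (by rw [LinearMap.neg_apply, hyz]; simp)
      (hd.exists_pow_ad_eq_zero (neg_ne_zero.2 hβ.1) hf y)
    refine (Submodule.ne_bot_iff _).2 ⟨_, ?_, hj⟩
    convert pow_ad_mem_wtg he (pow_ad_mem_wtg hf hy j) (j + n) using 1
    simp only [smul_zero, add_zero]
    congr 1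
    rw [reflDual, hz]
    push_cast
    module

lemma coroot_reflDual (hd : C.IsDiag) {α β : Module.Dual ℂ ↥C.h0} (hα : α ∈ C.Δzero)
    (hβ : β ∈ C.Δzero) :
    T.coroot (T.reflDual β α) = T.coroot α - β (T.coroot α) • T.coroot β := by
  have hα' := Δzero_subset_Δen hα
  have hβ' := Δzero_subset_Δen hβ
  have hγ := Δzero_subset_Δen (T.reflDual_mem hd hα hβ)
  set γ := T.reflDual β α with hγdef
  set w := T.coroot α - β (T.coroot α) • T.coroot β with hw
  have hsymm : T.cnorm α * α (T.coroot β) = T.cnorm β * β (T.coroot α) := by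
    rw [← T.cnorm_spec α hα', ← T.cnorm_spec β hβ', P.bil_symm]
  have h1 : T.cnorm γ • w = T.cnorm α • T.coroot γ := by
    rw [← sub_eq_zero]
    refine hd.eq_zero_of_bil_eq_zero fun y => ?_
    simp only [hw, Submodule.coe_sub, Submodule.coe_smul, map_sub, map_smul,
      LinearMap.sub_apply, LinearMap.smul_apply, smul_eq_mul,
      T.cnorm_spec α hα', T.cnorm_spec β hβ', T.cnorm_spec γ hγ]
    simp only [hγdef, reflDual, LinearMap.sub_apply, LinearMap.smul_apply, smul_eq_mul]
    linear_combination (T.cnorm (α - α (T.coroot β) • β)) * β y * hsymm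
  have h2 := congrArg γ h1
  rw [map_smul, map_smul, T.coroot_two γ hγ, hw, hγdef, T.reflDual_apply_sub hα' hβ',
    ← hγdef] at h2
  have h3 : T.cnorm γ = T.cnorm α := mul_right_cancel₀ two_ne_zero h2
  rw [h3] at h1
  exact (smul_right_injective _ (T.cnorm_ne_zero hd hα') h1).symm

end Torus

namespace Cartan

variable {P : PreT} {C : Cartan P}

lemma gr_le_iSup_wtg {k : Fin P.n → ℤ}
    (h : ∀ z : ↥C.h0, P.gr k ≤ ⨆ c, (LieAlgebra.ad ℂ P.g (z : P.g)).eigenspace c) :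
    P.gr k ≤ ⨆ α, C.wtg k α := by
  have := P.gfin
  refine (le_iSup_inf_iInf_eigenspace (fun z : ↥C.h0 => LieAlgebra.ad ℂ P.g (z : P.g)) (P.gr k)
    (fun z x hx => PreT.lie_mem_gr_zero (C.h0_le z.2) hx) (fun z w x _ => ?_) h).trans
    (iSup_le fun χ => ?_)
  · simp only [LieAlgebra.ad_apply]
    rw [leibniz_lie, C.h0_abelian _ z.2 _ w.2, zero_lie, zero_add]
  · rintro x ⟨hx, hxχ⟩
    by_cases hx0 : x = 0
    · rw [hx0]; exact Submodule.zero_mem _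
    have hx' : ∀ z : ↥C.h0, ⁅(z : P.g), x⁆ = χ z • x := fun z =>
      Module.End.mem_eigenspace_iff.1 ((Submodule.mem_iInf _).1 hxχ z)
    let α : Module.Dual ℂ ↥C.h0 :=
      { toFun := χ
        map_add' := fun z w => smul_left_injective ℂ hx0 (by
          simp only [← hx', add_smul, Submodule.coe_add, add_lie])
        map_smul' := fun c z => smul_left_injective ℂ hx0 (by
          simp only [← hx', Submodule.coe_smul, smul_lie, RingHom.id_apply, smul_eq_mul, mul_smul]) }
    exact Submodule.mem_iSup_of_mem α ⟨hx, mem_wtfull.2 hx'⟩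

lemma wtfull_le_eigenspace (α : Module.Dual ℂ ↥C.h0) (z : ↥C.h0) :
    C.wtfull α ≤ (LieAlgebra.ad ℂ P.g (z : P.g)).eigenspace (α z) := fun _ hx =>
  Module.End.mem_eigenspace_iff.2 (mem_wtfull.1 hx z)

end Cartan

namespace Torus

open Cartan

variable {P : PreT} {C : Cartan P} (T : Torus P C)

lemma gr_le_iSup_wtg_of_not_inΓ {P : PreT} {C : Cartan P} (T : Torus P C)
    {k : Fin P.n → ℤ} (hk : ¬ P.inΓ k) : P.gr k ≤ ⨆ α, C.wtg k α := by
  by_cases h0 : P.gr k = ⊥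
  · rw [h0]; exact bot_le
  obtain ⟨U, W, -, -, -, hUW, hU, hW⟩ := T.cond_M k hk h0
  refine gr_le_iSup_wtg fun z => hUW ▸ sup_le (fun u hu => ?_) ?_
  · refine Submodule.mem_iSup_of_mem 0 (Module.End.mem_eigenspace_iff.2 ?_)
    rw [LieAlgebra.ad_apply, hU _ (C.h0_le z.2) u hu, zero_smul]
  · rcases hW with rfl | ⟨-, -, hW⟩
    · exact bot_le
    · exact hW.trans (iSup₂_le fun α _ => (wtfull_le_eigenspace α z).trans (le_iSup _ _))

end Torus

namespace Toroidal

open Cartan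

variable {P : PreT} {C : Cartan P} {T : Torus P C} (X : Toroidal P C T)

lemma lie_E_zero {k : Fin P.n → ℤ} {x y : P.g} (hx : x ∈ P.gr 0) (hy : y ∈ P.gr k) :
    ⁅X.E 0 x, X.E k y⁆ = X.E k ⁅x, y⁆ := by
  rw [X.br_EE 0 k x y hx hy]; simp

lemma lie_E_cartan {k : Fin P.n → ℤ} {α : Module.Dual ℂ ↥C.h0} (h : ↥C.h0) {y : P.g}
    (hy : y ∈ C.wtg k α) : ⁅X.E 0 (h : P.g), X.E k y⁆ = α h • X.E k y := by
  rw [X.lie_E_zero (C.h0_le h.2) hy.1, mem_wtfull.1 hy.2, map_smul]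

lemma lie_Dop_zero_E {k : Fin P.n → ℤ} {y : P.g} (hy : y ∈ P.gr k) (i : Fin P.n) :
    ⁅X.Dop 0 i, X.E k y⁆ = (k i : ℂ) • X.E k y := by
  rw [X.br_DE 0 PreT.inΓ_zero i k y hy, zero_add]

end Toroidal

namespace TRep

open Cartan

variable {P : PreT} {C : Cartan P} {T : Torus P C} {X : Toroidal P C T} (M : TRep X)

/-- The weight space for the Cartan subalgebra `𝔥_{0̄}`. -/
def hSp (μ : Module.Dual ℂ ↥C.h0) : Submodule ℂ M.V :=
  ⨅ h : ↥C.h0, LinearMap.ker (M.ρ (X.E 0 (h : P.g)) - μ h • (1 : Module.End ℂ M.V))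

/-- The simultaneous weight space for `𝔥_{0̄}` and the degree derivations. -/
def hdSp (μ : Module.Dual ℂ ↥C.h0) (b : Fin P.n → ℂ) : Submodule ℂ M.V := M.hSp μ ⊓ M.dEig b

variable {M}

lemma mem_hSp {μ : Module.Dual ℂ ↥C.h0} {v : M.V} :
    v ∈ M.hSp μ ↔ ∀ h : ↥C.h0, M.ρ (X.E 0 (h : P.g)) v = μ h • v := by
  simp [hSp, Submodule.mem_iInf, sub_eq_zero]

lemma mem_dEig {b : Fin P.n → ℂ} {v : M.V} :
    v ∈ M.dEig b ↔ ∀ i, M.ρ (X.Dop 0 i) v = b i • v := by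
  simp [dEig, Submodule.mem_iInf, sub_eq_zero]

lemma wtSp_le_hdSp (w : C.Wt) : M.wtSp w ≤ M.hdSp w.1 w.2.2 := fun _ hv => ⟨hv.1.1, hv.2⟩

lemma hdSp_eq_wtSp (hlz : M.LevelZero) (μ : Module.Dual ℂ ↥C.h0) (b : Fin P.n → ℂ) :
    M.hdSp μ b = M.wtSp (μ, 0, b) := by
  refine le_antisymm (fun v hv => ⟨⟨hv.1, ?_⟩, hv.2⟩) (wtSp_le_hdSp _)
  have hK : ∀ i, M.ρ (X.K 0 i) = 0 := hlz
  simp [hK]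

lemma ρ_apply_comm (a b : X.τ) (v : M.V) :
    M.ρ a (M.ρ b v) = M.ρ b (M.ρ a v) + M.ρ ⁅a, b⁆ v := by
  rw [M.ρ_lie, LinearMap.sub_apply, Module.End.mul_apply, Module.End.mul_apply]; abel

lemma E_mem_hSp {k : Fin P.n → ℤ} {α μ : Module.Dual ℂ ↥C.h0} {x : P.g} (hx : x ∈ C.wtg k α)
    {v : M.V} (hv : v ∈ M.hSp μ) : M.ρ (X.E k x) v ∈ M.hSp (μ + α) := by
  rw [mem_hSp] at *
  intro h
  rw [ρ_apply_comm, hv h, X.lie_E_cartan h hx, map_smul, map_smul, LinearMap.smul_apply,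
    LinearMap.add_apply, add_smul]

lemma E_mem_dEig {k : Fin P.n → ℤ} {b : Fin P.n → ℂ} {x : P.g} (hx : x ∈ P.gr k)
    {v : M.V} (hv : v ∈ M.dEig b) : M.ρ (X.E k x) v ∈ M.dEig (fun i => b i + k i) := by
  rw [mem_dEig] at *
  intro i
  rw [ρ_apply_comm, hv i, X.lie_Dop_zero_E hx, map_smul, map_smul, LinearMap.smul_apply, add_smul]

lemma E_mem_hdSp {k : Fin P.n → ℤ} {α μ : Module.Dual ℂ ↥C.h0} {b : Fin P.n → ℂ} {x : P.g}
    (hx : x ∈ C.wtg k α) {v : M.V} (hv : v ∈ M.hdSp μ b) :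
    M.ρ (X.E k x) v ∈ M.hdSp (μ + α) (fun i => b i + k i) :=
  ⟨E_mem_hSp hx hv.1, E_mem_dEig hx.1 hv.2⟩

lemma ρ_E_lie (hlz : M.LevelZero) {k l : Fin P.n → ℤ} (hkl : k + l = 0) {x y : P.g}
    (hx : x ∈ P.gr k) (hy : y ∈ P.gr l) :
    M.ρ (X.E k x) * M.ρ (X.E l y) - M.ρ (X.E l y) * M.ρ (X.E k x) = M.ρ (X.E 0 ⁅x, y⁆) := by
  have hK : ∀ i, M.ρ (X.K 0 i) = 0 := hlz
  rw [← M.ρ_lie, X.br_EE k l x y hx hy, hkl, map_add, map_smul, map_sum]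
  simp only [map_smul, hK, smul_zero, Finset.sum_const_zero, add_zero]

lemma iSup_hdSp (hint : M.Integrable) : ⨆ p : Module.Dual ℂ ↥C.h0 × (Fin P.n → ℂ),
    M.hdSp p.1 p.2 = ⊤ :=
  top_le_iff.1 (hint.1.ge.trans (iSup_le fun w => (wtSp_le_hdSp w).trans
    (le_iSup (fun p : Module.Dual ℂ ↥C.h0 × (Fin P.n → ℂ) => M.hdSp p.1 p.2) (w.1, w.2.2))))

lemma commute_cartan (h h' : ↥C.h0) :
    Commute (M.ρ (X.E 0 (h : P.g))) (M.ρ (X.E 0 (h' : P.g))) := by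
  refine sub_eq_zero.1 ?_
  rw [← M.ρ_lie, X.lie_E_zero (C.h0_le h.2) (C.h0_le h'.2), C.h0_abelian _ h.2 _ h'.2, map_zero,
    map_zero]

lemma iSupIndep_hSp : iSupIndep M.hSp :=
  iSupIndep_of_eigenvalues (fun h : ↥C.h0 => M.ρ (X.E 0 (h : P.g))) commute_cartan M.hSp
    (fun α h => α h) (fun _ _ h => LinearMap.ext (congrFun h)) fun _ _ hx h => mem_hSp.1 hx h

lemma iSup_eigenspace_cartan (hint : M.Integrable) (h : ↥C.h0) :
    ⨆ c, (M.ρ (X.E 0 (h : P.g))).eigenspace c = ⊤ := by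
  refine top_le_iff.1 ((iSup_hdSp hint).ge.trans (iSup_le fun p => ?_))
  exact le_iSup_of_le (p.1 h) fun v hv => Module.End.mem_eigenspace_iff.2 (mem_hSp.1 hv.1 h)

/-- The algebra `𝔤_{0̄}` acts either trivially or faithfully. -/
lemma gr_zero_trivial_or_faithful (M : TRep X) : (∀ x ∈ P.gr 0, M.ρ (X.E 0 x) = 0) ∨
    ∀ x ∈ P.gr 0, M.ρ (X.E 0 x) = 0 → x = 0 := by
  rcases T.g0_ideals (P.gr 0 ⊓ LinearMap.ker (M.ρ ∘ₗ X.E 0)) inf_le_left (by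
    rintro x hx u ⟨hu, hu0⟩
    refine ⟨PreT.lie_mem_gr_zero hx hu, ?_⟩
    have hu' : M.ρ (X.E 0 u) = 0 := hu0
    rw [SetLike.mem_coe, LinearMap.mem_ker, LinearMap.comp_apply, ← X.lie_E_zero hx hu, M.ρ_lie, hu', mul_zero,
      zero_mul, sub_zero]) with h | h
  · refine Or.inr fun x hx hx0 => ?_
    have : x ∈ P.gr 0 ⊓ LinearMap.ker (M.ρ ∘ₗ X.E 0) := ⟨hx, hx0⟩
    rwa [h, Submodule.mem_bot] at this
  · refine Or.inl fun x hx => ?_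
    rw [← h] at hx
    exact hx.2

lemma isDiag_of_faithful (hint : M.Integrable)
    (hf : ∀ x ∈ P.gr 0, M.ρ (X.E 0 x) = 0 → x = 0) : C.IsDiag := by
  have := P.gfin
  have key : ∀ z : ↥C.h0, P.gr 0 ≤ ⨆ c, (LieAlgebra.ad ℂ P.g (z : P.g)).eigenspace c := by
    intro z
    have hst : ∀ x ∈ P.gr 0, LieAlgebra.ad ℂ P.g (z : P.g) x ∈ P.gr 0 := fun x hx =>
      PreT.lie_mem_gr_zero (C.h0_le z.2) hx
    have h1 := Submodule.inf_iSup_genEigenspace (k := ⊤) (f := LieAlgebra.ad ℂ P.g (z : P.g)) hst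
    have h2 := Module.End.iSup_maxGenEigenspace_eq_top (LieAlgebra.ad ℂ P.g (z : P.g))
    change ⨆ c, (LieAlgebra.ad ℂ P.g (z : P.g)).genEigenspace c ⊤ = ⊤ at h2
    rw [h2, inf_top_eq] at h1
    refine h1.le.trans (iSup_mono fun c => ?_)
    rintro x ⟨hx, hxc⟩
    refine Module.End.mem_eigenspace_iff.2 (sub_eq_zero.1 ?_)
    set d := LieAlgebra.ad ℂ P.g (z : P.g) - c • (1 : Module.End ℂ P.g) with hd
    have hdm : ∀ n : ℕ, (d ^ n) x ∈ P.gr 0 := by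
      intro n
      induction n with
      | zero => simpa using hx
      | succ n ih =>
        rw [pow_succ', Module.End.mul_apply]
        exact Submodule.sub_mem _ (hst _ ih) (Submodule.smul_mem _ _ ih)
    refine hf _ (by simpa [hd] using hdm 1) (LinearMap.ext fun v => ?_)
    have hv : v ∈ ⨆ a, (M.ρ (X.E 0 (z : P.g))).eigenspace a := by
      rw [iSup_eigenspace_cartan hint]; trivial
    induction hv using Submodule.iSup_induction' with
    | mem a v hv =>
      have hv' := Module.End.mem_eigenspace_iff.1 hv
      have step : ∀ y ∈ P.gr 0, M.ρ (X.E 0 (z : P.g)) (M.ρ (X.E 0 y) v) =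
          a • M.ρ (X.E 0 y) v + M.ρ (X.E 0 ⁅(z : P.g), y⁆) v := fun y hy => by
        rw [ρ_apply_comm, hv', map_smul, X.lie_E_zero (C.h0_le z.2) hy]
      have hpow : ∀ n : ℕ, ((M.ρ (X.E 0 (z : P.g)) - (a + c) • (1 : Module.End ℂ M.V)) ^ n)
          (M.ρ (X.E 0 x) v) = M.ρ (X.E 0 ((d ^ n) x)) v := by
        intro n
        induction n with
        | zero => simp
        | succ n ih =>
          rw [pow_succ', Module.End.mul_apply, ih, LinearMap.sub_apply, step _ (hdm n),
            pow_succ' d, Module.End.mul_apply]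
          simp only [hd, LinearMap.sub_apply, LinearMap.smul_apply, Module.End.one_apply, map_sub,
            map_smul, LieAlgebra.ad_apply]
          module
      have h3 : M.ρ (X.E 0 x) v ∈ (M.ρ (X.E 0 (z : P.g))).maxGenEigenspace (a + c) := by
        obtain ⟨n, hn⟩ := Module.End.mem_maxGenEigenspace _ _ _ |>.1 hxc
        refine (Module.End.mem_maxGenEigenspace _ _ _).2 ⟨n, ?_⟩
        rw [hpow, hn, map_zero, map_zero, LinearMap.zero_apply]
      have h4 := Module.End.mem_eigenspace_iff.1
        (maxGenEigenspace_le_eigenspace_of_iSup_eq_top (iSup_eigenspace_cartan hint z) _ h3)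
      rw [step x hx, add_smul, add_right_inj] at h4
      simp [h4]
    | zero => simp
    | add u w _ _ hu hw => rw [map_add, hu, hw, map_add]
  intro k
  by_cases hk : P.inΓ k
  · have hk' : P.inΓ (k - 0) := by simpa using hk
    simp only [wtg_congr hk', PreT.gr_congr hk']
    exact gr_le_iSup_wtg key
  · exact T.gr_le_iSup_wtg_of_not_inΓ hk

end TRep

lemma exists_nat_sum_sq {ι : Type*} {s : Finset ι} {f : ι → ℂ}
    (h : ∀ a ∈ s, ∃ z : ℤ, f a = z) : ∃ n : ℕ, ∑ a ∈ s, f a ^ 2 = n := by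
  classical
  choose! z hz using h
  refine ⟨∑ a ∈ s, (z a).natAbs ^ 2, ?_⟩
  rw [Nat.cast_sum]
  refine Finset.sum_congr rfl fun a ha => ?_
  have h1 : (((z a).natAbs ^ 2 : ℕ) : ℤ) = z a ^ 2 := by simp
  rw [hz a ha, ← Int.cast_pow, ← h1, Int.cast_natCast]

namespace Torus

open Cartan

variable {P : PreT} {C : Cartan P} (T : Torus P C)

/-- The sum of the squares of the values of a functional at the coroots of `𝔤_{0̄}`. -/
def corootSq (μ : Module.Dual ℂ ↥C.h0) : ℂ :=
  ∑ α ∈ C.finite_Δzero.toFinset, μ (T.coroot α) ^ 2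

lemma sum_coroot_mul (hd : C.IsDiag) {β : Module.Dual ℂ ↥C.h0} (hβ : β ∈ C.Δzero)
    (μ : Module.Dual ℂ ↥C.h0) :
    2 * ∑ α ∈ C.finite_Δzero.toFinset, μ (T.coroot α) * β (T.coroot α) =
      μ (T.coroot β) * T.corootSq β := by
  have hβ' := Δzero_subset_Δen hβ
  have h1 : ∑ α ∈ C.finite_Δzero.toFinset, μ (T.coroot α) * β (T.coroot α) =
      ∑ α ∈ C.finite_Δzero.toFinset,
        (-(μ (T.coroot α) * β (T.coroot α)) + μ (T.coroot β) * β (T.coroot α) ^ 2) := by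
    refine Finset.sum_nbij' (T.reflDual β) (T.reflDual β) ?_ ?_
      (fun α _ => T.reflDual_involutive hβ' α) (fun α _ => T.reflDual_involutive hβ' α) ?_
    · intro α hα
      simp only [Set.Finite.mem_toFinset] at hα ⊢
      exact T.reflDual_mem hd hα hβ
    · intro α hα
      simp only [Set.Finite.mem_toFinset] at hα ⊢
      exact T.reflDual_mem hd hα hβ
    · intro α hα
      simp only [Set.Finite.mem_toFinset] at hα
      rw [T.coroot_reflDual hd hα hβ]
      simp only [map_sub, map_smul, smul_eq_mul, T.coroot_two β hβ']
      ring
  rw [Finset.sum_add_distrib, Finset.sum_neg_distrib, ← Finset.mul_sum] at h1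
  rw [corootSq]
  linear_combination h1

lemma corootSq_sub (hd : C.IsDiag) {β : Module.Dual ℂ ↥C.h0} (hβ : β ∈ C.Δzero)
    (μ : Module.Dual ℂ ↥C.h0) :
    T.corootSq (μ - β) = T.corootSq μ + T.corootSq β * (1 - μ (T.coroot β)) := by
  have h1 := T.sum_coroot_mul hd hβ μ
  have h2 : T.corootSq (μ - β) = T.corootSq μ -
      2 * ∑ α ∈ C.finite_Δzero.toFinset, μ (T.coroot α) * β (T.coroot α) + T.corootSq β := by
    simp only [corootSq, Finset.mul_sum, ← Finset.sum_sub_distrib, ← Finset.sum_add_distrib,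
      LinearMap.sub_apply]
    exact Finset.sum_congr rfl fun α _ => by ring
  rw [h2, h1]; ring

lemma exists_nat_corootSq {μ : Module.Dual ℂ ↥C.h0}
    (hμ : ∀ α ∈ C.Δzero, ∃ z : ℤ, μ (T.coroot α) = z) : ∃ n : ℕ, T.corootSq μ = n :=
  exists_nat_sum_sq fun α hα => hμ α (by simpa using hα)

lemma corootSq_ne_zero (hd : C.IsDiag) {β : Module.Dual ℂ ↥C.h0} (hβ : β ∈ C.Δzero) :
    T.corootSq β ≠ 0 := by
  classical
  intro h0
  have h1 : ∃ n : ℕ, ∑ α ∈ C.finite_Δzero.toFinset.erase β, β (T.coroot α) ^ 2 = n := by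
    refine exists_nat_sum_sq fun α hα => ?_
    exact T.exists_int hd (Δzero_subset_Δen (by simpa using (Finset.mem_erase.1 hα).2))
      (Δzero_subset_Δen hβ)
  obtain ⟨n, hn⟩ := h1
  rw [corootSq, ← Finset.add_sum_erase _ _ (C.finite_Δzero.mem_toFinset.2 hβ), hn,
    T.coroot_two β (Δzero_subset_Δen hβ)] at h0
  have : (2 ^ 2 + n : ℕ) = 0 := by exact_mod_cast h0
  omega

lemma finite_setOf_coroot_small (hd : C.IsDiag) :
    {μ : Module.Dual ℂ ↥C.h0 | ∀ α ∈ C.Δzero, μ (T.coroot α) ∈ ({-1, 0, 1} : Set ℂ)}.Finite := by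
  have := (C.finite_Δzero).to_subtype
  let ev : Module.Dual ℂ ↥C.h0 → ↥C.Δzero → ℂ := fun μ α => μ (T.coroot α)
  have hev : Function.Injective ev := fun μ ν h => by
    refine sub_eq_zero.1 (T.eq_zero_of_coroots hd fun α hα => ?_)
    rw [LinearMap.sub_apply, sub_eq_zero]
    exact congrFun h ⟨α, hα⟩
  refine ((Set.Finite.pi' (t := fun _ : ↥C.Δzero => ({-1, 0, 1} : Set ℂ))
    fun _ => by simp).preimage hev.injOn).subset fun μ hμ α => hμ α α.2

end Torus

namespace TRep

open Cartan

variable {P : PreT} {C : Cartan P} {T : Torus P C} {X : Toroidal P C T} {M : TRep X}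

lemma isEndSl2 (hlz : M.LevelZero) {k : Fin P.n → ℤ} {α : Module.Dual ℂ ↥C.h0} (hα : α ∈ C.Δen)
    {e f : P.g} (he : e ∈ C.wtg k α) (hf : f ∈ C.wtg (-k) (-α))
    (hef : ⁅e, f⁆ = (T.coroot α : P.g)) :
    IsEndSl2 (M.ρ (X.E k e)) (M.ρ (X.E (-k) f)) (M.ρ (X.E 0 (T.coroot α : P.g))) where
  ef := by rw [ρ_E_lie hlz (add_neg_cancel k) he.1 hf.1, hef]
  he := by rw [← M.ρ_lie, X.lie_E_cartan _ he, T.coroot_two α hα, map_smul]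
  hf := by
    rw [← M.ρ_lie, X.lie_E_cartan _ hf, LinearMap.neg_apply, T.coroot_two α hα, neg_smul,
      map_neg, map_smul]

lemma exists_int_of_mem_hSp (hd : C.IsDiag) (hlz : M.LevelZero) (hint : M.Integrable)
    {μ : Module.Dual ℂ ↥C.h0} {v : M.V} (hv : v ∈ M.hSp μ) (hv0 : v ≠ 0)
    {α : Module.Dual ℂ ↥C.h0} (hα : α ∈ C.Δzero) : ∃ z : ℤ, μ (T.coroot α) = z := by
  obtain ⟨e, he, f, hf, hef⟩ := T.exists_triple hd (Δzero_subset_Δen hα) hα.2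
  exact (isEndSl2 hlz (Δzero_subset_Δen hα) he hf hef).exists_int hv0 (mem_hSp.1 hv _)
    (hint.2 _ _ hα.1 _ he v) (hint.2 _ _ (neg_ne_zero.2 hα.1) _ hf)

lemma exists_fg_gr_zero_invariant (hd : C.IsDiag) (hlz : M.LevelZero) (hint : M.Integrable)
    {U : Submodule ℂ M.V} (hU : U.FG) :
    ∃ N : Submodule ℂ M.V, N.FG ∧ U ≤ N ∧ ∀ x ∈ P.gr 0, ∀ u ∈ N, M.ρ (X.E 0 x) u ∈ N := by
  have := P.gfin
  have hspan : Submodule.span ℂ {x | ∃ α, x ∈ C.wtg 0 α} = P.gr 0 := by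
    refine le_antisymm (Submodule.span_le.2 fun x ⟨α, hx⟩ => hx.1) ((hd 0).trans ?_)
    exact iSup_le fun α x hx => Submodule.subset_span ⟨α, hx⟩
  obtain ⟨t, ht, htspan⟩ := (Submodule.fg_span_iff_fg_span_finset_subset _).1
    (hspan ▸ IsNoetherian.noetherian (P.gr 0))
  rw [hspan] at htspan
  let x : Fin t.card → P.g := fun i => (t.equivFin.symm i : P.g)
  have hrange : Set.range x = (t : Set P.g) := by
    have : x = Subtype.val ∘ t.equivFin.symm := rfl
    rw [this, Set.range_comp, t.equivFin.symm.surjective.range_eq, Set.image_univ]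
    simp
  have hxm : ∀ i, ∃ α, x i ∈ C.wtg 0 α := fun i => ht (by simp [x])
  have hmap : Submodule.span ℂ (Set.range fun i => M.ρ (X.E 0 (x i))) =
      (P.gr 0).map (M.ρ ∘ₗ X.E 0) := by
    rw [htspan, Submodule.map_span, ← hrange, ← Set.range_comp]; rfl
  obtain ⟨N, hN, hUN, hst⟩ := exists_fg_invariant_of_locFin (x := fun i => M.ρ (X.E 0 (x i))) (by
    intro i j
    obtain ⟨α, hα⟩ := hxm i
    obtain ⟨β, hβ⟩ := hxm j
    rw [ρ_E_lie hlz (add_zero 0) hα.1 hβ.1, hmap]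
    exact ⟨_, PreT.lie_mem_gr_zero hα.1 hβ.1, rfl⟩) (by
    intro i v
    obtain ⟨α, hα⟩ := hxm i
    by_cases h0 : α = 0
    · subst h0
      refine isLocFinAt_of_mem_iSup_eigenspace ?_
      have := iSup_eigenspace_cartan hint (⟨x i, mem_h0_of_mem_wtg hα⟩ : ↥C.h0)
      rw [this]; trivial
    · obtain ⟨n, hn⟩ := hint.2 _ _ h0 _ hα v
      exact isLocFinAt_of_pow_eq_zero hn) hU
  refine ⟨N, hN, hUN, fun y hy u hu => ?_⟩
  rw [htspan, ← hrange] at hy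
  induction hy using Submodule.span_induction with
  | mem y hy => obtain ⟨i, rfl⟩ := hy; exact hst i u hu
  | zero => simp
  | add a b _ _ ha hb => rw [map_add, map_add]; exact N.add_mem ha hb
  | smul c a _ ha => rw [map_smul, map_smul]; exact N.smul_mem c ha

lemma hdSp_fg (hlz : M.LevelZero) (hfin : M.FinWt) (μ : Module.Dual ℂ ↥C.h0)
    (b : Fin P.n → ℂ) : (M.hdSp μ b).FG := by
  rw [hdSp_eq_wtSp hlz, ← Module.Finite.iff_fg]
  exact hfin _

lemma E_zero_mem_hdSp {α μ : Module.Dual ℂ ↥C.h0} {b : Fin P.n → ℂ} {x : P.g}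
    (hx : x ∈ C.wtg 0 α) {v : M.V} (hv : v ∈ M.hdSp μ b) :
    M.ρ (X.E 0 x) v ∈ M.hdSp (μ + α) b := by
  simpa using E_mem_hdSp hx hv

/-- For a fixed degree, only finitely many `𝔥_{0̄}`-weights occur. -/
lemma finite_hdSp_ne_bot (hd : C.IsDiag) (hlz : M.LevelZero) (hint : M.Integrable)
    (hfin : M.FinWt) (b : Fin P.n → ℂ) : {μ | M.hdSp μ b ≠ ⊥}.Finite := by
  obtain ⟨N, hN, hFN, hst⟩ := exists_fg_gr_zero_invariant hd hlz hint
    (Submodule.fg_biSup (T.finite_setOf_coroot_small hd).toFinset (fun μ => M.hdSp μ b)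
      fun μ _ => hdSp_fg hlz hfin μ b)
  have hint' : ∀ μ, M.hdSp μ b ≠ ⊥ → ∀ α ∈ C.Δzero, ∃ z : ℤ, μ (T.coroot α) = z := by
    intro μ hμ α hα
    obtain ⟨v, hv, hv0⟩ := (Submodule.ne_bot_iff _).1 hμ
    exact exists_int_of_mem_hSp hd hlz hint hv.1 hv0 hα
  have main : ∀ n : ℕ, ∀ μ, T.corootSq μ = n → M.hdSp μ b ≤ N := by
    intro n
    induction n using Nat.strong_induction_on with
    | _ n ih =>
    intro μ hμn
    by_cases hbot : M.hdSp μ b = ⊥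
    · rw [hbot]; exact bot_le
    by_cases hsmall : ∀ α ∈ C.Δzero, μ (T.coroot α) ∈ ({-1, 0, 1} : Set ℂ)
    · refine le_trans ?_ hFN
      exact le_biSup (fun μ => M.hdSp μ b) ((T.finite_setOf_coroot_small hd).mem_toFinset.2 hsmall)
    obtain ⟨β, hβ, z, hz, hz2⟩ : ∃ β ∈ C.Δzero, ∃ z : ℤ, μ (T.coroot β) = z ∧ 2 ≤ z := by
      push Not at hsmall
      obtain ⟨α, hα, hne⟩ := hsmall
      obtain ⟨z, hz⟩ := hint' μ hbot α hα
      have hz' : z ≠ -1 ∧ z ≠ 0 ∧ z ≠ 1 := by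
        refine ⟨?_, ?_, ?_⟩ <;> rintro rfl <;> exact hne (by simp [hz])
      by_cases h : 2 ≤ z
      · exact ⟨α, hα, z, hz, h⟩
      · refine ⟨-α, neg_mem_Δzero hd hα, -z, ?_, by omega⟩
        rw [T.coroot_neg α (Δzero_subset_Δen hα), map_neg, hz, Int.cast_neg]
    have hβ' := Δzero_subset_Δen hβ
    obtain ⟨e, he, f, hf, hef⟩ := T.exists_triple hd hβ' hβ.2
    have ht := (isEndSl2 (M := M) hlz hβ' he hf hef).symm
    rw [neg_zero] at hf
    have hle : M.hdSp (μ - β) b ≤ N := by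
      by_cases hbot' : M.hdSp (μ - β) b = ⊥
      · rw [hbot']; exact bot_le
      obtain ⟨p, hp⟩ := T.exists_nat_corootSq (hint' _ hbot')
      obtain ⟨q, hq⟩ := T.exists_nat_corootSq (μ := β) fun α hα =>
        T.exists_int hd (Δzero_subset_Δen hα) hβ'
      have hq0 : q ≠ 0 := fun h => T.corootSq_ne_zero hd hβ (by rw [hq, h, Nat.cast_zero])
      refine ih p ?_ _ hp
      have h1 := T.corootSq_sub hd hβ μ
      rw [hp, hμn, hq, hz] at h1
      have h2 : (p : ℤ) = n + q * (1 - z) := by exact_mod_cast h1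
      have h3 : (q : ℤ) * (1 - z) < 0 := mul_neg_of_pos_of_neg (by omega) (by omega)
      omega
    intro v hv
    obtain ⟨a, ha⟩ := hint.2 _ _ hβ.1 _ he v
    refine ht.mem_of_forall_ne (N := N) (q := -(z : ℂ)) (n := a) ?_ ?_ ?_ ?_ ?_ ?_
    · rw [neg_zero]; exact hst f hf.1
    · exact hst e he.1
    · rw [LinearMap.neg_apply, mem_hSp.1 hv.1, hz]; simp
    · rw [neg_zero]
      refine hle ?_
      rw [sub_eq_add_neg]
      exact E_zero_mem_hdSp hf hv
    · rw [ha]; exact N.zero_mem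
    · intro i hi
      have : -z = i := by exact_mod_cast hi
      omega
  have hall : ∀ μ, M.hdSp μ b ≤ N := fun μ => by
    by_cases hbot : M.hdSp μ b = ⊥
    · rw [hbot]; exact bot_le
    obtain ⟨n, hn⟩ := T.exists_nat_corootSq (hint' _ hbot)
    exact main n μ hn
  have hne : ∀ μ : {μ | M.hdSp μ b ≠ ⊥}, ∃ v ∈ M.hdSp μ b, v ≠ 0 := fun μ =>
    (Submodule.ne_bot_iff _).1 μ.2
  choose w hw hw0 using hne
  have hli : LinearIndependent ℂ w :=
    (iSupIndep_hSp.comp Subtype.val_injective).linearIndependent _ (fun μ => (hw μ).1) hw0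
  have : Module.Finite ℂ N := Module.Finite.iff_fg.2 hN
  have hli' : LinearIndependent ℂ (fun μ => (⟨w μ, hall μ (hw μ)⟩ : N)) :=
    LinearIndependent.of_comp N.subtype hli
  have := hli'.finite
  exact Set.toFinite _

end TRep

namespace Torus

open Cartan

variable {P : PreT} {C : Cartan P} (T : Torus P C)

/-- A nonempty finite set of weights contains an element that is maximal with respect to adding
positive roots. -/
lemma exists_maximal_weight (hd : C.IsDiag) {S : Set (Module.Dual ℂ ↥C.h0)} (hS : S.Finite)
    (hne : S.Nonempty) : ∃ μ ∈ S, ∀ α ∈ T.pos, μ + α ∉ S := by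
  have := hS.to_subtype
  let r : S → S → Prop := fun μ ν => ∃ l : List (Module.Dual ℂ ↥C.h0), l ≠ [] ∧
    (∀ α ∈ l, α ∈ T.pos) ∧ (μ : Module.Dual ℂ ↥C.h0) = ν + l.sum
  have htrans : IsTrans S r := ⟨by
    rintro a b c ⟨l, hl, hlp, h⟩ ⟨l', hl', hlp', h'⟩
    refine ⟨l' ++ l, by simp [hl], ?_, ?_⟩
    · intro α hα
      rcases List.mem_append.1 hα with hα | hα
      exacts [hlp' α hα, hlp α hα]
    · rw [h, h', List.sum_append, add_assoc]⟩
  have hirr : Std.Irrefl r := ⟨by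
    rintro a ⟨l, hl, hlp, h⟩
    exact T.sum_pos_ne_zero hd l hl hlp (by simpa using h.symm)⟩
  obtain ⟨μ, -, hμ⟩ := (Finite.wellFounded_of_trans_of_irrefl r).has_min Set.univ
    ⟨⟨_, hne.some_mem⟩, trivial⟩
  exact ⟨μ, μ.2, fun α hα hmem => hμ ⟨_, hmem⟩ trivial ⟨[α], by simp, by simpa using hα, by simp⟩⟩

end Torus

namespace Toroidal

open Cartan

variable {P : PreT} {C : Cartan P} {T : Torus P C} (X : Toroidal P C T)

lemma lie_tauZ_E {t : X.τ} (ht : t ∈ X.tauZ) {l : Fin P.n → ℤ} {α : Module.Dual ℂ ↥C.h0}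
    (hα : α ≠ 0) {y : P.g} (hy : y ∈ C.wtg l α) :
    ∃ k, ∃ z ∈ C.wtg k α, ⁅t, X.E l y⁆ = X.E k z := by
  rcases ht with ⟨k, x, hx, rfl⟩ | ⟨r, i, hr, rfl | rfl⟩
  · refine ⟨k + l, ⁅x, y⁆, by simpa using lie_mem_wtg hx hy, ?_⟩
    have h0 : P.bil x y = 0 := by
      by_contra h
      exact hα (by simpa using add_eq_zero_of_bil_ne_zero hx.2 hy.2 h)
    rw [X.br_EE k l x y hx.1 hy.1, h0, zero_smul, add_zero]
  · refine ⟨l, 0, Submodule.zero_mem _, ?_⟩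
    rw [← lie_skew, X.br_EK l y hy.1, neg_zero, map_zero]
  · refine ⟨r + l, (l i : ℂ) • y, ?_, ?_⟩
    · rw [wtg_congr (l := l) (by simpa using hr)]
      exact Submodule.smul_mem _ _ hy
    · rw [X.br_DE r hr i l y hy.1, map_smul]

lemma lie_mem_tauP {t s : X.τ} (ht : t ∈ X.tauZ) (hs : s ∈ X.tauP) : ⁅t, s⁆ ∈ X.tauP := by
  obtain ⟨α, hα, l, y, hy, rfl⟩ := hs
  obtain ⟨k, z, hz, h⟩ := X.lie_tauZ_E ht (T.pos_sub hα).1 hy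
  exact ⟨α, hα, k, z, hz, h⟩

end Toroidal

namespace TRep

open Cartan

variable {P : PreT} {C : Cartan P} {T : Torus P C} {X : Toroidal P C T} {M : TRep X}

lemma exists_hdSp_ne_bot (hirr : M.Irr) (hint : M.Integrable) : ∃ μ b, M.hdSp μ b ≠ ⊥ := by
  have := hirr.1
  by_contra! h
  have h1 := iSup_hdSp hint
  simp only [h, iSup_bot] at h1
  exact bot_ne_top h1

lemma ρ_mem_of_homogeneous {N : Submodule ℂ M.V} {u : M.V}
    (hE : ∀ k, ∀ x ∈ P.gr k, M.ρ (X.E k x) u ∈ N) (hZ : ∀ t ∈ X.tauZ, M.ρ t u ∈ N) (t : X.τ) :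
    M.ρ t u ∈ N := by
  have ht : t ∈ (⊤ : Submodule ℂ X.τ) := trivial
  rw [← X.span_top] at ht
  induction ht using Submodule.span_induction with
  | mem t ht =>
    rcases ht with (⟨k, x, hx, rfl⟩ | ⟨r, i, hr, rfl⟩) | ⟨r, i, hr, rfl⟩
    · exact hE k x hx
    · exact hZ _ (Or.inr ⟨r, i, hr, Or.inl rfl⟩)
    · exact hZ _ (Or.inr ⟨r, i, hr, Or.inr rfl⟩)
  | zero => simp
  | add a b _ _ ha hb => rw [map_add]; exact N.add_mem ha hb
  | smul c a _ ha => rw [map_smul]; exact N.smul_mem c ha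

lemma ρ_mem_of_wtg {N : Submodule ℂ M.V} {u : M.V} {k : Fin P.n → ℤ}
    (hE : ∀ α, ∀ x ∈ C.wtg k α, M.ρ (X.E k x) u ∈ N) {x : P.g} (hx : x ∈ ⨆ α, C.wtg k α) :
    M.ρ (X.E k x) u ∈ N := by
  induction hx using Submodule.iSup_induction' with
  | mem α x hx => exact hE α x hx
  | zero => simp
  | add a b _ _ ha hb => rw [map_add, map_add]; exact N.add_mem ha hb

lemma ρ_mem_of_triangular (hd : C.IsDiag) {N : Submodule ℂ M.V} {u : M.V}
    (hP : ∀ t ∈ X.tauP, M.ρ t u ∈ N) (hZ : ∀ t ∈ X.tauZ, M.ρ t u ∈ N)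
    (hM : ∀ t ∈ X.tauM, M.ρ t u ∈ N) (t : X.τ) : M.ρ t u ∈ N := by
  refine ρ_mem_of_homogeneous (fun k x hx => ρ_mem_of_wtg (fun α x hx => ?_) (hd k hx)) hZ t
  by_cases hα : α = 0
  · subst hα
    exact hZ _ (Or.inl ⟨k, x, hx, rfl⟩)
  by_cases hx0 : x = 0
  · simp [hx0]
  rcases T.pos_total α ⟨hα, k, (Submodule.ne_bot_iff _).2 ⟨x, hx, hx0⟩⟩ with h | h
  · exact hP _ ⟨α, h, k, x, hx, rfl⟩
  · exact hM _ ⟨α, h, k, x, hx, rfl⟩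

lemma ρ_E_root_eq_zero (h0 : ∀ x ∈ P.gr 0, M.ρ (X.E 0 x) = 0) {k : Fin P.n → ℤ}
    {α : Module.Dual ℂ ↥C.h0} (hα : α ≠ 0) {x : P.g} (hx : x ∈ C.wtg k α) :
    M.ρ (X.E k x) = 0 := by
  obtain ⟨h, hh⟩ : ∃ h, α h ≠ 0 := by
    by_contra! hc
    exact hα (LinearMap.ext hc)
  have h1 := M.ρ_lie (X.E 0 (h : P.g)) (X.E k x)
  rw [X.lie_E_cartan h hx, h0 _ (C.h0_le h.2), zero_mul, mul_zero, sub_zero, map_smul] at h1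
  exact (smul_eq_zero.1 h1).resolve_left hh

lemma ρ_E_eq_zero_of_inΓ (h0 : ∀ x ∈ P.gr 0, M.ρ (X.E 0 x) = 0) {k : Fin P.n → ℤ}
    (hk : P.inΓ k) {x : P.g} (hx : x ∈ P.gr k) : M.ρ (X.E k x) = 0 := by
  have hgr : P.gr k = P.gr 0 := PreT.gr_congr (by simpa using hk)
  let D := Submodule.span ℂ {z | ∃ x ∈ P.gr 0, ∃ y ∈ P.gr 0, z = ⁅x, y⁆}
  have hD : D ≤ P.gr 0 := Submodule.span_le.2 (by
    rintro z ⟨x, hx, y, hy, rfl⟩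
    exact PreT.lie_mem_gr_zero hx hy)
  have hxD : x ∈ D := by
    rcases T.g0_ideals D hD fun x hx u hu => Submodule.subset_span ⟨x, hx, u, hD hu, rfl⟩
      with h | h
    · obtain ⟨x, hx, y, hy, hxy⟩ := T.g0_nonabelian
      have : ⁅x, y⁆ ∈ D := Submodule.subset_span ⟨x, hx, y, hy, rfl⟩
      rw [h, Submodule.mem_bot] at this
      exact absurd this hxy
    · rw [h, ← hgr]; exact hx
  clear hx
  induction hxD using Submodule.span_induction with
  | mem z hz =>
    obtain ⟨x, hx, y, hy, rfl⟩ := hz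
    rw [← X.lie_E_zero hx (hgr ▸ hy), M.ρ_lie, h0 x hx, zero_mul, mul_zero, sub_zero]
  | zero => simp
  | add a b _ _ ha hb => rw [map_add, map_add, ha, hb, add_zero]
  | smul c a _ ha => rw [map_smul, map_smul, ha, smul_zero]

lemma mem_wtSp (hlz : M.LevelZero) {μ : Module.Dual ℂ ↥C.h0} {b : Fin P.n → ℂ} {v : M.V}
    (hv : v ∈ M.hdSp μ b) : ∃ w : C.Wt, v ∈ M.wtSp w :=
  ⟨(μ, 0, b), hdSp_eq_wtSp hlz μ b ▸ hv⟩

lemma eq_top_of_mem (hirr : M.Irr) {v : M.V} (hv0 : v ≠ 0) (U : Submodule ℂ M.V)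
    (hU : ∀ t : X.τ, ∀ u ∈ U, M.ρ t u ∈ U) (hv : v ∈ U) : U = ⊤ :=
  (hirr.2 U hU).resolve_left fun h => hv0 ((Submodule.mem_bot ℂ).1 (h ▸ hv))

/-- A module on which `𝔤_{0̄}` acts trivially is a highest weight module. -/
lemma isHW_of_trivial (hirr : M.Irr) (hint : M.Integrable) (hlz : M.LevelZero)
    (h0 : ∀ x ∈ P.gr 0, M.ρ (X.E 0 x) = 0) : M.IsHW := by
  obtain ⟨μ, b, hne⟩ := exists_hdSp_ne_bot hirr hint
  obtain ⟨v, hv, hv0⟩ := (Submodule.ne_bot_iff _).1 hne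
  refine ⟨v, hv0, mem_wtSp hlz hv, eq_top_of_mem hirr hv0, ?_, fun U hUle hU => ?_, hlz⟩
  · rintro t ⟨α, hα, k, x, hx, rfl⟩
    rw [ρ_E_root_eq_zero h0 (T.pos_sub hα).1 hx, LinearMap.zero_apply]
  · refine (hirr.2 U fun t u hu => ?_).imp_right fun h : U = ⊤ =>
      le_antisymm hUle (h.symm ▸ le_top)
    refine ρ_mem_of_homogeneous (fun k x hx => ?_) (fun t ht => hU t ht u hu) t
    by_cases hk : P.inΓ k
    · rw [ρ_E_eq_zero_of_inΓ h0 hk hx]; exact U.zero_mem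
    · refine ρ_mem_of_wtg (fun α x hx => ?_) (T.gr_le_iSup_wtg_of_not_inΓ hk hx)
      by_cases hα : α = 0
      · subst hα
        exact hU _ (Or.inl ⟨k, x, hx, rfl⟩) u hu
      · rw [ρ_E_root_eq_zero h0 hα hx]; exact U.zero_mem

/-- Only finitely many `𝔥_{0̄}`-weights occur in the degrees congruent to a given one. -/
lemma finite_weights (hd : C.IsDiag) (hlz : M.LevelZero) (hint : M.Integrable)
    (hfin : M.FinWt) (b : Fin P.n → ℂ) :
    {μ | ∃ k : Fin P.n → ℤ, M.hdSp μ (fun i => b i + k i) ≠ ⊥}.Finite := by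
  let R : Set (Fin P.n → ℤ) := {k | ∀ i, k i ∈ Set.Ico 0 (P.m i : ℤ)}
  have hR : R.Finite := Set.Finite.pi' fun i => Set.finite_Ico _ _
  let S : Set (Module.Dual ℂ ↥C.h0) := ⋃ k ∈ R, {μ | M.hdSp μ (fun i => b i + k i) ≠ ⊥}
  have hS : S.Finite := hR.biUnion fun k _ => finite_hdSp_ne_bot hd hlz hint hfin _
  refine ((Set.finite_singleton 0).union (hS.image2 (· + ·) C.finite_Δzero)).subset ?_
  rintro μ ⟨k, hk⟩
  by_cases hμ : μ = 0
  · exact Or.inl hμ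
  right
  obtain ⟨v, hv, hv0⟩ := (Submodule.ne_bot_iff _).1 hk
  obtain ⟨β, hβ, z, hz, hz0⟩ : ∃ β ∈ C.Δzero, ∃ z : ℤ, μ (T.coroot β) = z ∧ 0 < z := by
    obtain ⟨α, hα, hne⟩ : ∃ α ∈ C.Δzero, μ (T.coroot α) ≠ 0 := by
      by_contra! h
      exact hμ (T.eq_zero_of_coroots hd h)
    obtain ⟨z, hz⟩ := exists_int_of_mem_hSp hd hlz hint hv.1 hv0 hα
    have hz' : z ≠ 0 := by rintro rfl; exact hne (by simp [hz])
    by_cases h : 0 < z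
    · exact ⟨α, hα, z, hz, h⟩
    · refine ⟨-α, neg_mem_Δzero hd hα, -z, ?_, by omega⟩
      rw [T.coroot_neg α (Δzero_subset_Δen hα), map_neg, hz, Int.cast_neg]
  have hβ' := Δzero_subset_Δen hβ
  let r : Fin P.n → ℤ := fun i => P.m i * (k i / P.m i)
  have hr : P.inΓ r := fun i => dvd_mul_right _ _
  obtain ⟨e, he, f, hf, hef⟩ := T.exists_triple hd hβ' (k := r)
    (by rw [wtg_congr (l := 0) (by simpa using hr)]; exact hβ.2)
  have ht := (isEndSl2 (M := M) hlz hβ' he hf hef).symm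
  have hfv0 : M.ρ (X.E (-r) f) v ≠ 0 := by
    intro h
    obtain ⟨a, ha⟩ := hint.2 _ _ hβ.1 _ he v
    refine hv0 ((Submodule.mem_bot ℂ).1 (ht.mem_of_forall_ne (N := ⊥) (q := -(z : ℂ)) (n := a)
      (by simp) (by simp) ?_ (by simp [h]) (by simp [ha]) fun i hi => ?_))
    · rw [LinearMap.neg_apply, mem_hSp.1 hv.1, hz]; simp
    · have : -z = i := by exact_mod_cast hi
      omega
  refine ⟨μ - β, ?_, β, hβ, sub_add_cancel μ β⟩
  refine Set.mem_biUnion (x := k - r) (fun i => ?_) ((Submodule.ne_bot_iff _).2 ⟨_, ?_, hfv0⟩)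
  · have hm : (0 : ℤ) < P.m i := by exact_mod_cast P.mpos i
    have h1 : (k - r) i = k i % P.m i := by
      rw [Pi.sub_apply, Int.emod_def]
    rw [h1]
    exact ⟨Int.emod_nonneg _ hm.ne', Int.emod_lt_of_pos _ hm⟩
  · convert E_mem_hdSp hf hv using 1
    rw [sub_eq_add_neg]
    congr 1
    ext i
    push_cast [Pi.sub_apply, Pi.neg_apply]
    ring

/-- There is a nonzero weight vector annihilated by `τ̃₊`. -/
lemma exists_highest_weight_vector (hd : C.IsDiag) (hirr : M.Irr) (hlz : M.LevelZero)
    (hint : M.Integrable) (hfin : M.FinWt) :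
    ∃ μ b, ∃ v ∈ M.hdSp μ b, v ≠ 0 ∧ ∀ t ∈ X.tauP, M.ρ t v = 0 := by
  obtain ⟨μ₀, b, hne⟩ := exists_hdSp_ne_bot hirr hint
  obtain ⟨μ, ⟨k, hk⟩, hmax⟩ := T.exists_maximal_weight hd (finite_weights hd hlz hint hfin b)
    ⟨μ₀, 0, by simpa using hne⟩
  obtain ⟨v, hv, hv0⟩ := (Submodule.ne_bot_iff _).1 hk
  refine ⟨μ, _, v, hv, hv0, ?_⟩
  rintro t ⟨α, hα, l, x, hx, rfl⟩
  by_contra h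
  refine hmax α hα ⟨k + l, (Submodule.ne_bot_iff _).2 ⟨_, ?_, h⟩⟩
  convert E_mem_hdSp hx hv using 2
  ext i
  push_cast [Pi.add_apply]
  ring

lemma tauZ_mem_hSp {t : X.τ} (ht : t ∈ X.tauZ) {μ : Module.Dual ℂ ↥C.h0} {v : M.V}
    (hv : v ∈ M.hSp μ) : M.ρ t v ∈ M.hSp μ := by
  rcases ht with ⟨k, x, hx, rfl⟩ | ⟨r, i, hr, rfl | rfl⟩
  · simpa using E_mem_hSp hx hv
  · rw [mem_hSp] at *
    intro h
    rw [ρ_apply_comm, hv h, X.br_EK 0 _ (C.h0_le h.2), map_smul, map_zero, LinearMap.zero_apply,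
      add_zero]
  · rw [mem_hSp] at *
    intro h
    rw [ρ_apply_comm, hv h, ← lie_skew, X.br_DE r hr i 0 _ (C.h0_le h.2), map_smul]
    simp

lemma tauZ_mem_Vplus {t : X.τ} (ht : t ∈ X.tauZ) {v : M.V} (hv : v ∈ M.Vplus) :
    M.ρ t v ∈ M.Vplus := by
  have hv' : ∀ s ∈ X.tauP, M.ρ s v = 0 := by simpa [Vplus, Submodule.mem_iInf] using hv
  simp only [Vplus, Submodule.mem_iInf, LinearMap.mem_ker]
  intro s hs
  have h1 := ρ_apply_comm t s v
  rw [hv' s hs, map_zero, hv' _ (X.lie_mem_tauP ht hs), add_zero] at h1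
  exact h1.symm

/-- The `τ̃₀`-module generated by a highest weight vector is irreducible. -/
lemma eq_bot_or_eq_u0span (hd : C.IsDiag) (hirr : M.Irr) {μ : Module.Dual ℂ ↥C.h0} {v : M.V}
    (hv : v ∈ M.hSp μ) (hvP : ∀ t ∈ X.tauP, M.ρ t v = 0) {U : Submodule ℂ M.V}
    (hUle : U ≤ M.u0span v) (hU : ∀ t ∈ X.tauZ, ∀ u ∈ U, M.ρ t u ∈ U) :
    U = ⊥ ∨ U = M.u0span v := by
  have hle : M.u0span v ≤ M.hSp μ ⊓ M.Vplus := sInf_le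
    ⟨⟨hv, by simpa [Vplus, Submodule.mem_iInf] using hvP⟩, fun t ht u hu =>
      ⟨tauZ_mem_hSp ht hu.1, tauZ_mem_Vplus ht hu.2⟩⟩
  have hUP : ∀ u ∈ U, ∀ t ∈ X.tauP, M.ρ t u = 0 := fun u hu => by
    simpa [Vplus, Submodule.mem_iInf] using (hle (hUle hu)).2
  let N : Submodule ℂ M.V := sInf {N | U ≤ N ∧ ∀ t ∈ X.tauM, ∀ u ∈ N, M.ρ t u ∈ N}
  have hUN : U ≤ N := le_sInf fun N hN => hN.1
  have hNM : ∀ t ∈ X.tauM, ∀ u ∈ N, M.ρ t u ∈ N := fun t ht u hu =>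
    Submodule.mem_sInf.2 fun N' hN' => hN'.2 t ht u (Submodule.mem_sInf.1 hu N' hN')
  let N' : Submodule ℂ M.V := N ⊓ ⨅ t : X.τ, N.comap (M.ρ t)
  have hNN' : N ≤ N' := sInf_le ⟨fun u hu => ⟨hUN hu, (Submodule.mem_iInf _).2
      (ρ_mem_of_triangular hd (fun t ht => by rw [hUP u hu t ht]; exact N.zero_mem)
        (fun t ht => hUN (hU t ht u hu)) fun t ht => hNM t ht u (hUN hu))⟩, fun y hy w hw => by
    have hw' : ∀ t, M.ρ t w ∈ N := (Submodule.mem_iInf _).1 hw.2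
    refine ⟨hw' y, (Submodule.mem_iInf _).2 fun t => ?_⟩
    rw [Submodule.mem_comap, ρ_apply_comm]
    exact N.add_mem (hNM y hy _ (hw' t)) (hw' _)⟩
  rcases hirr.2 N fun t u hu => (Submodule.mem_iInf _).1 (hNN' hu).2 t with h | h
  · exact Or.inl (le_bot_iff.1 (h ▸ hUN))
  refine Or.inr (le_antisymm hUle fun u hu => ?_)
  let I : Set (Module.Dual ℂ ↥C.h0) := {ν | ∃ l : List (Module.Dual ℂ ↥C.h0), l ≠ [] ∧
    (∀ α ∈ l, α ∈ T.pos) ∧ ν = μ - l.sum}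
  have hNB : N ≤ U ⊔ ⨆ ν ∈ I, M.hSp ν := sInf_le ⟨le_sup_left, by
    rintro t ⟨α, hα, k, x, hx, rfl⟩ w hw
    have hmap : U ⊔ ⨆ ν ∈ I, M.hSp ν ≤ (U ⊔ ⨆ ν ∈ I, M.hSp ν).comap (M.ρ (X.E k x)) := by
      refine sup_le (fun w hw => ?_) (iSup₂_le fun ν ⟨l, _, hlp, hν⟩ w hw => ?_)
      · have hI : μ + α ∈ I := ⟨[-α], by simp, by simpa using hα, by simp⟩
        exact le_sup_of_le_right (le_biSup M.hSp hI) (E_mem_hSp hx (hle (hUle hw)).1)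
      · have hI : ν + α ∈ I := ⟨-α :: l, by simp, by simpa using ⟨hα, hlp⟩, by simp [hν]; abel⟩
        exact le_sup_of_le_right (le_biSup M.hSp hI) (E_mem_hSp hx hw)
    exact hmap hw⟩
  have hu' : u ∈ U ⊔ ⨆ ν ∈ I, M.hSp ν := hNB (h ▸ trivial)
  obtain ⟨a, ha, w, hw, rfl⟩ := Submodule.mem_sup.1 hu'
  have hwμ : w ∈ M.hSp μ := by
    simpa using (M.hSp μ).sub_mem (hle hu).1 (hle (hUle ha)).1
  have hw' : w ∈ ⨆ ν ≠ μ, M.hSp ν := by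
    refine (iSup₂_le fun ν hν => ?_ : (⨆ ν ∈ I, M.hSp ν) ≤ ⨆ ν ≠ μ, M.hSp ν) hw
    refine le_iSup₂_of_le (f := fun ν (_ : ν ≠ μ) => M.hSp ν) ν ?_ le_rfl
    rintro rfl
    obtain ⟨l, hl, hlp, hsum⟩ := hν
    exact T.sum_pos_ne_zero hd l hl hlp (sub_eq_self.1 hsum.symm)
  have hw0 : w = 0 := Submodule.disjoint_def.1 (iSupIndep_hSp μ) w hwμ hw'
  rw [hw0, add_zero]
  exact ha

end TRep

section Statements

variable {P : PreT} {C : Cartan P} {T : Torus P C} {X : Toroidal P C T}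

/-- Corollary 3.6: every irreducible integrable level zero `τ̃`-module with
finite-dimensional weight spaces is a level zero highest weight module. -/
theorem statement3 (M : TRep X) (hirr : M.Irr) (hint : M.Integrable)
    (hlz : M.LevelZero) (hfin : M.FinWt) : M.IsHW := by
  rcases M.gr_zero_trivial_or_faithful with h0 | hf
  · exact TRep.isHW_of_trivial hirr hint hlz h0
  · have hd := TRep.isDiag_of_faithful hint hf
    obtain ⟨μ, b, v, hv, hv0, hvP⟩ := TRep.exists_highest_weight_vector hd hirr hlz hint hfin
    exact ⟨v, hv0, TRep.mem_wtSp hlz hv, TRep.eq_top_of_mem hirr hv0, hvP,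
      fun U hUle hU => TRep.eq_bot_or_eq_u0span hd hirr hv.1 hvP hUle hU, hlz⟩

end Statements
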